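/- arXiv:1407.2977 — 6 statements merged into one kernel-verified Lean document; each statement's English description precedes it below -/
import Mathlib

section
/- Let X be a real Banach space admitting a C¹ Lipschitz bump function, let f : X → (−∞,+∞] be a proper function, let x be a point with f(x) < +∞, and let Δ ∈ X* be a continuous linear functional. Then the following are equivalent: (1) there exists a function g : X → ℝ which is Fréchet differentiable at x such that f − g attains a local minimum at x and Δ = Dg(x); (2) liminf_{h→0} (f(x+h) − f(x) − Δ(h))/‖h‖ ≥ 0; (3) there exists a C¹ function g : X → ℝ such that f − g attains a local minimum at x and Δ = Dg(x). -/
open Filter Topology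

variable {X : Type*} [NormedAddCommGroup X] [NormedSpace ℝ X]

/-- `X` admits a `C¹` Lipschitz bump function: a `C¹` Lipschitz function with
bounded nonempty support. -/
def HasC1LipBump (X : Type*) [NormedAddCommGroup X] [NormedSpace ℝ X] : Prop :=
  ∃ b : X → ℝ, ContDiff ℝ 1 b ∧ (∃ K : NNReal, LipschitzWith K b) ∧
    Bornology.IsBounded (Function.support b) ∧ (Function.support b).Nonempty

theorem Real.smoothTransition.exists_norm_deriv_le :
    ∃ C : ℝ, ∀ t, ‖deriv Real.smoothTransition t‖ ≤ C := by
  have hcont : Continuous (deriv Real.smoothTransition) :=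
    (Real.smoothTransition.contDiff (n := 1)).continuous_deriv le_rfl
  obtain ⟨C, hC⟩ := isCompact_Icc.exists_bound_of_continuousOn (s := Set.Icc (0 : ℝ) 1)
    hcont.continuousOn
  have hC0 : 0 ≤ C := (norm_nonneg _).trans (hC 0 (by simp))
  refine ⟨C, fun t => ?_⟩
  by_cases h0 : t < 0
  · have : deriv Real.smoothTransition t = 0 := IsLocalMin.deriv_eq_zero <|
      Eventually.of_forall fun s => by
        rw [Real.smoothTransition.zero_of_nonpos h0.le]
        exact Real.smoothTransition.nonneg s
    simpa [this] using hC0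
  by_cases h1 : 1 < t
  · have : deriv Real.smoothTransition t = 0 := IsLocalMax.deriv_eq_zero <|
      Eventually.of_forall fun s => by
        rw [Real.smoothTransition.one_of_one_le h1.le]
        exact Real.smoothTransition.le_one s
    simpa [this] using hC0
  exact hC t ⟨not_lt.1 h0, not_lt.1 h1⟩

/-- A bump function yields a `C¹` function with bounded derivative, vanishing near the origin
and equal to `1` outside the unit ball. -/
theorem HasC1LipBump.exists_transition (hbump : HasC1LipBump X) :
    ∃ (S : X → ℝ) (r K : ℝ), ContDiff ℝ 1 S ∧ (∀ h, 0 ≤ S h) ∧ (∀ h, S h ≤ 1) ∧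
      0 < r ∧ r < 1 ∧ (∀ h, ‖fderiv ℝ S h‖ ≤ K) ∧ (∀ h, ‖h‖ ≤ r → S h = 0) ∧
      (∀ h, 1 ≤ ‖h‖ → S h = 1) := by
  obtain ⟨b, hb, ⟨L, hL⟩, hbdd, ⟨x₀, hx₀⟩⟩ := hbump
  rw [Function.mem_support] at hx₀
  obtain ⟨R, hR0, hR⟩ := hbdd.subset_ball_lt 0 x₀
  obtain ⟨C, hC⟩ := Real.smoothTransition.exists_norm_deriv_le
  let β : X → ℝ := fun h => 2 * (b x₀)⁻¹ * b (x₀ + R • h)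
  have hβ : ContDiff ℝ 1 β := contDiff_const.mul
    (hb.comp (contDiff_const.add (contDiff_const.smul contDiff_id)))
  have hβL : LipschitzWith (‖2 * (b x₀)⁻¹‖₊ * (L * ‖R‖₊)) β := by
    refine LipschitzWith.of_dist_le_mul fun u v => ?_
    have h1 := hL.dist_le_mul (x₀ + R • u) (x₀ + R • v)
    rw [dist_add_left, dist_smul₀] at h1
    simp only [β, Real.dist_eq, ← mul_sub, abs_mul (2 * (b x₀)⁻¹)] at h1 ⊢
    push_cast
    rw [mul_assoc, mul_assoc, Real.norm_eq_abs]
    gcongr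
  have hβ0 : β 0 = 2 := by simp [β, hx₀]
  obtain ⟨r, hr0, hr⟩ : ∃ r > 0, ∀ h, ‖h‖ < r → 1 < β h := by
    have : ∀ᶠ h in 𝓝 (0 : X), 1 < β h :=
      hβ.continuous.continuousAt.eventually (lt_mem_nhds (by rw [hβ0]; norm_num))
    obtain ⟨r, hr0, hr⟩ := Metric.eventually_nhds_iff.1 this
    exact ⟨r, hr0, fun h hh => hr (by simpa using hh)⟩
  refine ⟨fun h => 1 - Real.smoothTransition (β h), min (r / 2) (1 / 2),
    C * (‖2 * (b x₀)⁻¹‖₊ * (L * ‖R‖₊) : NNReal), ?_, ?_, ?_, ?_, ?_, ?_, ?_, ?_⟩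
  · exact contDiff_const.sub (Real.smoothTransition.contDiff.comp hβ)
  · exact fun h => sub_nonneg.2 (Real.smoothTransition.le_one _)
  · exact fun h => sub_le_self _ (Real.smoothTransition.nonneg _)
  · positivity
  · exact (min_le_right _ _).trans_lt (by norm_num)
  · intro h
    have h1 : HasDerivAt Real.smoothTransition (deriv Real.smoothTransition (β h)) (β h) :=
      ((Real.smoothTransition.contDiff (n := 1)).differentiable one_ne_zero _).hasDerivAt
    have h2 : HasFDerivAt β (fderiv ℝ β h) h := (hβ.differentiable one_ne_zero h).hasFDerivAt
    have h3 : HasFDerivAt (fun h => 1 - Real.smoothTransition (β h))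
        (-(deriv Real.smoothTransition (β h) • fderiv ℝ β h)) h :=
      (h1.comp_hasFDerivAt h h2).const_sub 1
    rw [h3.fderiv, norm_neg, norm_smul]
    gcongr
    · exact (norm_nonneg _).trans (hC 0)
    · exact hC _
    · exact norm_fderiv_le_of_lipschitz ℝ hβL
  · intro h hh
    have : ‖h‖ < r := (hh.trans (min_le_left _ _)).trans_lt (by linarith)
    simp [Real.smoothTransition.one_of_one_le (hr h this).le]
  · intro h hh
    have : b (x₀ + R • h) = 0 := by
      by_contra hne
      have := hR (Function.mem_support.2 hne)
      rw [Metric.mem_ball, dist_self_add_left, norm_smul, Real.norm_of_nonneg hR0.le] at this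
      nlinarith
    simp [β, this]

/-- A pointwise convergent series of `C¹` functions is `C¹` if the derivatives of its terms have
disjoint supports and tend uniformly to zero. -/
theorem hasFDerivAt_tsum_of_disjoint_fderiv {u : ℕ → X → ℝ} {c : ℕ → ℝ}
    (hu : ∀ n, ContDiff ℝ 1 (u n)) (hsum : ∀ h, Summable fun n => u n h)
    (hc : Tendsto c atTop (𝓝 0)) (huc : ∀ n h, ‖fderiv ℝ (u n) h‖ ≤ c n)
    (hdisj : ∀ m n h, fderiv ℝ (u m) h ≠ 0 → fderiv ℝ (u n) h ≠ 0 → m = n) :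
    ContDiff ℝ 1 (fun h => ∑' n, u n h) ∧
      ∀ h, HasFDerivAt (fun h => ∑' n, u n h) (∑' n, fderiv ℝ (u n) h) h := by
  have hunif : TendstoUniformly (fun N h => ∑ n ∈ Finset.range N, fderiv ℝ (u n) h)
      (fun h => ∑' n, fderiv ℝ (u n) h) atTop := by
    rw [Metric.tendstoUniformly_iff]
    intro ε hε
    obtain ⟨N₀, hN₀⟩ := eventually_atTop.1 (hc.eventually (gt_mem_nhds hε))
    filter_upwards [eventually_ge_atTop N₀] with N hN h
    by_cases hall : ∀ n, fderiv ℝ (u n) h = 0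
    · simpa [hall] using hε
    obtain ⟨m, hm⟩ := not_forall.1 hall
    have hz : ∀ n, n ≠ m → fderiv ℝ (u n) h = 0 := fun n hn => by
      by_contra h0
      exact hn (hdisj n m h h0 hm)
    rw [tsum_eq_single m hz]
    by_cases hmN : m < N
    · rw [Finset.sum_eq_single_of_mem m (Finset.mem_range.2 hmN) fun n _ hn => hz n hn]
      simpa using hε
    · rw [Finset.sum_eq_zero fun n hn => hz n (by have := Finset.mem_range.1 hn; omega),
        dist_zero_right]
      exact (huc m h).trans_lt (hN₀ m (by omega))
  have hderiv : ∀ h, HasFDerivAt (fun h => ∑' n, u n h) (∑' n, fderiv ℝ (u n) h) h := by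
    intro h
    refine hasFDerivAt_of_tendstoUniformly hunif (fun N y => ?_)
      (fun y => (hsum y).hasSum.tendsto_sum_nat) h
    exact HasFDerivAt.fun_sum fun n _ => ((hu n).differentiable one_ne_zero y).hasFDerivAt
  refine ⟨contDiff_one_iff_hasFDerivAt.2 ⟨_, ?_, hderiv⟩, hderiv⟩
  exact hunif.continuous <| Eventually.frequently <| Eventually.of_forall fun N =>
    continuous_finsetSum _ fun n _ => (hu n).continuous_fderiv one_ne_zero

/-- Given an upward closed property of a real number and an index, holding eventually for each
positive number, there is a positive null sequence along which it eventually holds. -/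
theorem exists_pos_tendsto_zero_eventually {P : ℝ → ℕ → Prop}
    (hmono : ∀ ε ε' n, ε ≤ ε' → P ε n → P ε' n) (hP : ∀ ε > 0, ∀ᶠ n in atTop, P ε n) :
    ∃ e : ℕ → ℝ, (∀ n, 0 < e n) ∧ Tendsto e atTop (𝓝 0) ∧ ∀ᶠ n in atTop, P (e n) n := by
  have hbdd : ∀ n, BddBelow {ε | 0 < ε ∧ P ε n} := fun n => ⟨0, fun ε hε => hε.1.le⟩
  have hnn : ∀ n, 0 ≤ sInf {ε | 0 < ε ∧ P ε n} := fun n => Real.sInf_nonneg fun ε hε => hε.1.le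
  have hlim : Tendsto (fun n => sInf {ε | 0 < ε ∧ P ε n}) atTop (𝓝 0) := by
    refine tendsto_order.2 ⟨fun a ha => Eventually.of_forall fun n => ha.trans_le (hnn n),
      fun a ha => ?_⟩
    filter_upwards [hP (a / 2) (half_pos ha)] with n hn
    exact (csInf_le (hbdd n) ⟨half_pos ha, hn⟩).trans_lt (half_lt_self ha)
  refine ⟨fun n => sInf {ε | 0 < ε ∧ P ε n} + 1 / ((n : ℝ) + 1), fun n => ?_, ?_, ?_⟩
  · have := hnn n
    positivity
  · simpa using hlim.add tendsto_one_div_add_atTop_nhds_zero_nat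
  · filter_upwards [hP 1 one_pos] with n hn
    obtain ⟨ε, hε, hlt⟩ := exists_lt_of_csInf_lt (s := {ε | 0 < ε ∧ P ε n}) ⟨1, one_pos, hn⟩
      (lt_add_of_pos_right _ (Nat.one_div_pos_of_nat (α := ℝ) (n := n)))
    exact hmono _ _ n hlt.le hε.2

/-- On a space with a `C¹` Lipschitz bump function, there is a geometric scale such that, for every
positive null sequence `e`, some `C¹` function vanishing to first order at the origin dominates
`e n` times the scale on the `n`-th annulus. -/
theorem HasC1LipBump.exists_contDiff_ge (hbump : HasC1LipBump X) :
    ∃ r : ℝ, 0 < r ∧ r < 1 ∧ ∀ e : ℕ → ℝ, (∀ n, 0 < e n) → Tendsto e atTop (𝓝 0) →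
      ∃ ψ : X → ℝ, ContDiff ℝ 1 ψ ∧ ψ 0 = 0 ∧ HasFDerivAt ψ (0 : X →L[ℝ] ℝ) 0 ∧
        ∀ n h, r ^ (n + 1) ≤ ‖h‖ → e n * r ^ (n + 1) ≤ ψ h := by
  obtain ⟨S, r, K, hS, hS0, hS1, hr0, hr1, hK, hin, hout⟩ := hbump.exists_transition
  refine ⟨r, hr0, hr1, fun e he helim => ?_⟩
  have hpow : ∀ n : ℕ, 0 < r ^ n := fun n => pow_pos hr0 n
  let u : ℕ → X → ℝ := fun n h => e n * r ^ (n + 1) * S ((r ^ (n + 1))⁻¹ • h)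
  have hu : ∀ n, ContDiff ℝ 1 (u n) := fun n =>
    contDiff_const.mul (hS.comp (contDiff_const.smul contDiff_id))
  have hu0 : ∀ n h, 0 ≤ u n h := fun n h =>
    mul_nonneg (mul_nonneg (he n).le (hpow _).le) (hS0 _)
  have hnorm : ∀ (n : ℕ) (h : X), ‖(r ^ (n + 1))⁻¹ • h‖ = ‖h‖ / r ^ (n + 1) := fun n h => by
    rw [norm_smul, norm_inv, Real.norm_of_nonneg (hpow _).le, inv_mul_eq_div]
  have hfd : ∀ n h, fderiv ℝ (u n) h = e n • fderiv ℝ S ((r ^ (n + 1))⁻¹ • h) := fun n h => by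
    have h1 : HasFDerivAt (fun h : X => (r ^ (n + 1))⁻¹ • h)
        ((r ^ (n + 1))⁻¹ • ContinuousLinearMap.id ℝ X) h := (hasFDerivAt_id h).const_smul _
    have h2 := (hS.differentiable one_ne_zero ((r ^ (n + 1))⁻¹ • h)).hasFDerivAt
    have h3 : HasFDerivAt (u n) _ h := (h2.comp h h1).const_mul (e n * r ^ (n + 1))
    rw [h3.fderiv]
    ext v
    have := (hpow (n + 1)).ne'
    simp
    field_simp
  have hsum : ∀ h, Summable fun n => u n h := fun h => by
    obtain ⟨B, hB⟩ := helim.bddAbove_range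
    refine Summable.of_nonneg_of_le (fun n => hu0 n h) (fun n => ?_)
      (((summable_nat_add_iff 1).2 (summable_geometric_of_lt_one hr0.le hr1)).mul_left B)
    have := hB ⟨n, rfl⟩
    calc u n h ≤ e n * r ^ (n + 1) :=
          mul_le_of_le_one_right (mul_nonneg (he n).le (hpow _).le) (hS1 _)
      _ ≤ B * r ^ (n + 1) := by have := hpow (n + 1); gcongr
  have hmem : ∀ n h, fderiv ℝ (u n) h ≠ 0 → r ^ (n + 2) < ‖h‖ ∧ ‖h‖ < r ^ (n + 1) := by
    intro n h hne
    have hne' : fderiv ℝ S ((r ^ (n + 1))⁻¹ • h) ≠ 0 := fun h0 => hne (by rw [hfd, h0, smul_zero])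
    constructor <;> by_contra! hle <;> apply hne'
    · refine IsLocalMin.fderiv_eq_zero (Eventually.of_forall fun y => ?_)
      rw [hin _ (by rw [hnorm, div_le_iff₀ (hpow _)]; exact hle.trans_eq (by ring))]
      exact hS0 y
    · refine IsLocalMax.fderiv_eq_zero (Eventually.of_forall fun y => ?_)
      rw [hout ((r ^ (n + 1))⁻¹ • h) (by rwa [hnorm, le_div_iff₀ (hpow _), one_mul])]
      exact hS1 y
  have hdisj : ∀ m n h, fderiv ℝ (u m) h ≠ 0 → fderiv ℝ (u n) h ≠ 0 → m = n := by
    intro m n h hm hn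
    have h1 := (pow_lt_pow_iff_right_of_lt_one₀ hr0 hr1).1 ((hmem m h hm).1.trans (hmem n h hn).2)
    have h2 := (pow_lt_pow_iff_right_of_lt_one₀ hr0 hr1).1 ((hmem n h hn).1.trans (hmem m h hm).2)
    omega
  obtain ⟨hψ, hψ'⟩ := hasFDerivAt_tsum_of_disjoint_fderiv (c := fun n => e n * K) hu hsum
    (by simpa using helim.mul_const K)
    (fun n h => by
      rw [hfd, norm_smul, Real.norm_of_nonneg (he n).le]
      exact mul_le_mul_of_nonneg_left (hK _) (he n).le) hdisj
  refine ⟨_, hψ, ?_, ?_, fun n h hn => ?_⟩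
  · simp [u, hin 0 (by simpa using hr0.le)]
  · have hz : ∀ n, fderiv ℝ (u n) 0 = 0 := fun n => by
      by_contra hne
      have := (hmem n 0 hne).1
      rw [norm_zero] at this
      exact this.not_ge (hpow _).le
    simpa [hz] using hψ' 0
  · refine le_trans (le_of_eq ?_) ((hsum h).le_tsum n fun m _ => hu0 m h)
    simp only [u]
    rw [hout _ (by rwa [hnorm, le_div_iff₀ (hpow _), one_mul]), mul_one]

theorem EReal.coe_sub_coe_le_sub_coe_iff {z : EReal} (hz : z ≠ ⊥) (a p q : ℝ) :
    (a : EReal) - (p : EReal) ≤ z - (q : EReal) ↔ (a : EReal) + ((q - p : ℝ) : EReal) ≤ z := by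
  induction z with
  | bot => exact absurd rfl hz
  | top => simp
  | coe z =>
    norm_cast
    constructor <;> intro h <;> linarith

theorem stmt0 [CompleteSpace X] (hbump : HasC1LipBump X)
    (f : X → EReal) (hf_bot : ∀ y, f y ≠ ⊥) (hf_proper : ∃ y, f y ≠ ⊤)
    (x : X) (hx : f x ≠ ⊤) (Δ : X →L[ℝ] ℝ) :
    ((∃ g : X → ℝ, HasFDerivAt g Δ x ∧
        ∀ᶠ y in 𝓝 x, f x - (g x : EReal) ≤ f y - (g y : EReal)) ↔
      (∀ ε > (0:ℝ), ∃ δ > (0:ℝ), ∀ h : X, ‖h‖ < δ →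
        f x + ((Δ h - ε * ‖h‖ : ℝ) : EReal) ≤ f (x + h))) ∧
    ((∀ ε > (0:ℝ), ∃ δ > (0:ℝ), ∀ h : X, ‖h‖ < δ →
        f x + ((Δ h - ε * ‖h‖ : ℝ) : EReal) ≤ f (x + h)) ↔
      (∃ g : X → ℝ, ContDiff ℝ 1 g ∧ fderiv ℝ g x = Δ ∧
        ∀ᶠ y in 𝓝 x, f x - (g x : EReal) ≤ f y - (g y : EReal))) := by
  obtain ⟨a, ha⟩ : ∃ a : ℝ, (a : EReal) = f x := ⟨_, EReal.coe_toReal hx (hf_bot x)⟩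
  simp only [← ha, EReal.coe_sub_coe_le_sub_coe_iff (hf_bot _)]
  have h12 : (∃ g : X → ℝ, HasFDerivAt g Δ x ∧
      ∀ᶠ y in 𝓝 x, (a : EReal) + ((g y - g x : ℝ) : EReal) ≤ f y) →
      ∀ ε > (0:ℝ), ∃ δ > (0:ℝ), ∀ h : X, ‖h‖ < δ →
        (a : EReal) + ((Δ h - ε * ‖h‖ : ℝ) : EReal) ≤ f (x + h) := by
    rintro ⟨g, hg, hmin⟩ ε hε
    obtain ⟨δ, hδ, hball⟩ := Metric.eventually_nhds_iff.1 (hmin.and (hg.isLittleO.def hε))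
    refine ⟨δ, hδ, fun h hh => ?_⟩
    obtain ⟨h1, h2⟩ := hball (y := x + h) (by simpa using hh)
    refine le_trans ?_ h1
    rw [add_sub_cancel_left, Real.norm_eq_abs] at h2
    have := (abs_le.1 h2).1
    norm_cast
    linarith
  have h23 : (∀ ε > (0:ℝ), ∃ δ > (0:ℝ), ∀ h : X, ‖h‖ < δ →
        (a : EReal) + ((Δ h - ε * ‖h‖ : ℝ) : EReal) ≤ f (x + h)) →
      ∃ g : X → ℝ, ContDiff ℝ 1 g ∧ fderiv ℝ g x = Δ ∧
        ∀ᶠ y in 𝓝 x, (a : EReal) + ((g y - g x : ℝ) : EReal) ≤ f y := by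
    intro hlim
    obtain ⟨r, hr0, hr1, hr⟩ := hbump.exists_contDiff_ge
    obtain ⟨e, he, helim, hP⟩ := exists_pos_tendsto_zero_eventually
      (P := fun ε n => ∀ h : X, ‖h‖ ≤ r ^ n →
        (a : EReal) + ((Δ h - ε * r ^ (n + 1) : ℝ) : EReal) ≤ f (x + h))
      (fun ε ε' n hle hε h hh => le_trans (by
        have := mul_le_mul_of_nonneg_right hle (pow_pos hr0 (n + 1)).le
        norm_cast
        linarith) (hε h hh))
      (fun ε hε => by
        obtain ⟨δ, hδ, hball⟩ := hlim (ε * r) (by positivity)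
        filter_upwards [(tendsto_pow_atTop_nhds_zero_of_lt_one hr0.le hr1).eventually
          (gt_mem_nhds hδ)] with n hn h hh
        refine le_trans ?_ (hball h (hh.trans_lt hn))
        have := mul_le_mul_of_nonneg_left hh (mul_pos hε hr0).le
        norm_cast
        rw [pow_succ]
        linarith)
    obtain ⟨ψ, hψ, hψ0, hψ', hψge⟩ := hr e he helim
    obtain ⟨N, hN⟩ := eventually_atTop.1 hP
    refine ⟨fun y => Δ (y - x) - ψ (y - x), ?_, ?_, ?_⟩
    · have hsub : ContDiff ℝ 1 fun y : X => y - x := contDiff_id.sub contDiff_const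
      exact (Δ.contDiff.comp hsub).sub (hψ.comp hsub)
    · have hsub : HasFDerivAt (fun y : X => y - x) (ContinuousLinearMap.id ℝ X) x :=
        (hasFDerivAt_id x).sub_const x
      have h1 : HasFDerivAt ψ (0 : X →L[ℝ] ℝ) (x - x) := by rwa [sub_self]
      have h2 : HasFDerivAt (fun y => ψ (y - x)) _ x :=
        HasFDerivAt.comp (f := fun y => y - x) x h1 hsub
      have h3 : HasFDerivAt (fun y => Δ (y - x)) _ x := Δ.hasFDerivAt.comp x hsub
      simpa using (h3.fun_sub h2).fderiv
    · filter_upwards [Metric.ball_mem_nhds x (pow_pos hr0 N)] with y hy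
      rw [mem_ball_iff_norm] at hy
      simp only [sub_self, map_zero, hψ0, sub_zero]
      obtain ⟨h, rfl⟩ : ∃ h, y = x + h := ⟨y - x, by abel⟩
      rw [add_sub_cancel_left] at hy ⊢
      rcases eq_or_ne h 0 with rfl | hne
      · simp [hψ0, ha]
      obtain ⟨n, hn1, hn2⟩ := exists_nat_pow_near_of_lt_one (norm_pos_iff.2 hne)
        (hy.le.trans (pow_le_one₀ hr0.le hr1.le)) hr0 hr1
      have hNn := (pow_lt_pow_iff_right_of_lt_one₀ hr0 hr1).1 (hn1.trans hy)
      refine le_trans ?_ (hN n (by omega) h hn2)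
      have := hψge n h hn1.le
      norm_cast
      linarith
  have h31 : (∃ g : X → ℝ, ContDiff ℝ 1 g ∧ fderiv ℝ g x = Δ ∧
        ∀ᶠ y in 𝓝 x, (a : EReal) + ((g y - g x : ℝ) : EReal) ≤ f y) →
      ∃ g : X → ℝ, HasFDerivAt g Δ x ∧
        ∀ᶠ y in 𝓝 x, (a : EReal) + ((g y - g x : ℝ) : EReal) ≤ f y := by
    rintro ⟨g, hg, rfl, hmin⟩
    exact ⟨g, (hg.differentiable one_ne_zero x).hasFDerivAt, hmin⟩
  exact ⟨⟨h12, fun h => h31 (h23 h)⟩, h23, fun h => h12 (h31 h)⟩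
end

section
/- Let X be a real Banach space admitting a C¹ Lipschitz bump function. Let f : X → ℝ be lower semicontinuous and let g : X → ℝ be uniformly continuous on some neighborhood of each point. Then for every x ∈ X, every Δ ∈ D⁻(f+g)(x) and every ε > 0, there exist points x₁, x₂ ∈ X and functionals Δ₁ ∈ D⁻f(x₁), Δ₂ ∈ D⁻g(x₂) such that: (1) ‖x₁ − x‖ < ε and ‖x₂ − x‖ < ε; (2) |f(x₁) − f(x)| < ε and |g(x₂) − g(x)| < ε; (3) ‖Δ₁ + Δ₂ − Δ‖ < ε; and (4) ‖x₁ − x₂‖ · max{‖Δ₁‖, ‖Δ₂‖} < ε. -/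
open Filter Topology

variable {X : Type*} [NormedAddCommGroup X] [NormedSpace ℝ X]

/-- The Fréchet subdifferential of a real-valued function `f` at `x`. -/
def subdiff (f : X → ℝ) (x : X) : Set (X →L[ℝ] ℝ) :=
  {Δ | ∀ ε > (0:ℝ), ∃ δ > (0:ℝ), ∀ h : X, ‖h‖ < δ →
    f x + Δ h - ε * ‖h‖ ≤ f (x + h)}

/-- A smooth substitute for the norm at unit scale: `θ` is differentiable with derivative bounded
by `L`, vanishes at the origin, takes values in `[0, T]`, and is at least `1` off the open unit
ball. -/
structure IsUnitPenalty {E : Type*} [NormedAddCommGroup E] [NormedSpace ℝ E]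
    (θ : E → ℝ) (L T : ℝ) : Prop where
  differentiable : Differentiable ℝ θ
  norm_fderiv_le : ∀ u, ‖fderiv ℝ θ u‖ ≤ L
  map_zero : θ 0 = 0
  nonneg : ∀ u, 0 ≤ θ u
  le : ∀ u, θ u ≤ T
  one_le : ∀ u, 1 ≤ ‖u‖ → 1 ≤ θ u

theorem HasC1LipBump.exists_isUnitPenalty (h : HasC1LipBump X) :
    ∃ (θ : X → ℝ) (L T : ℝ), 0 < L ∧ 0 < T ∧ IsUnitPenalty θ L T := by
  obtain ⟨b, hb, ⟨K, hK⟩, hbd, x₀, hx₀⟩ := h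
  have hx₀ : b x₀ ≠ 0 := hx₀
  obtain ⟨R, hR0, hR⟩ : ∃ R : ℝ, 0 < R ∧ ∀ u, R ≤ ‖u‖ → b (x₀ + u) = 0 := by
    obtain ⟨R, hR⟩ := hbd.subset_closedBall x₀
    refine ⟨max R 0 + 1, by positivity, fun u hu => ?_⟩
    by_contra hne
    have := hR (show x₀ + u ∈ Function.support b from hne)
    rw [mem_closedBall_iff_norm, add_sub_cancel_left] at this
    have := le_max_left R 0
    linarith
  set c : X → ℝ := fun u => b (x₀ + R • u) / b x₀ with hc
  set M : ℝ := K * R / |b x₀| with hM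
  have hM0 : 0 ≤ M := by positivity
  have hlip : ∀ u v, |c u - c v| ≤ M * ‖u - v‖ := by
    intro u v
    have h1 := hK.dist_le_mul (x₀ + R • u) (x₀ + R • v)
    rw [Real.dist_eq, dist_eq_norm, add_sub_add_left_eq_sub, ← smul_sub, norm_smul,
      Real.norm_of_nonneg hR0.le] at h1
    simp only [hc, hM]
    rw [← sub_div, abs_div, div_mul_eq_mul_div]
    gcongr
    linarith
  have hd : Differentiable ℝ c := by
    have := hb.differentiable one_ne_zero
    simp only [hc]
    fun_prop
  have hc0 : c 0 = 1 := by simp [hc, hx₀]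
  have hc1 : ∀ u, 1 ≤ ‖u‖ → c u = 0 := by
    intro u hu
    have : b (x₀ + R • u) = 0 := hR _ (by
      rw [norm_smul, Real.norm_of_nonneg hR0.le]
      nlinarith)
    simp [hc, this]
  have hcb : ∀ u, |1 - c u| ≤ 1 + M := by
    intro u
    by_cases hu : 1 ≤ ‖u‖
    · rw [hc1 u hu]
      simpa using hM0
    · have := hlip 0 u
      rw [hc0, zero_sub, norm_neg] at this
      nlinarith
  have hfd : ∀ u, ‖fderiv ℝ c u‖ ≤ M := fun u =>
    (LipschitzWith.of_dist_le_mul (K := ⟨M, hM0⟩) fun u v => by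
      rw [Real.dist_eq, dist_eq_norm]
      exact hlip u v) |> norm_fderiv_le_of_lipschitz ℝ
  refine ⟨fun u => (1 - c u) ^ 2, 2 * (1 + M) * M + 1, (1 + M) ^ 2, by positivity, by positivity,
    ⟨by fun_prop, fun u => ?_, by simp [hc0], fun u => sq_nonneg _, fun u => ?_, fun u hu => ?_⟩⟩
  · have h1 : HasFDerivAt (fun u => (1 - c u) ^ 2) _ u :=
      ((hd u).hasFDerivAt.const_sub 1).pow 2
    rw [h1.fderiv, norm_smul, norm_neg]
    have h2 : ‖(2 : ℕ) • (1 - c u) ^ (2 - 1)‖ ≤ 2 * (1 + M) := by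
      simpa [abs_mul] using hcb u
    calc _ ≤ 2 * (1 + M) * M := by
          gcongr
          exact hfd u
      _ ≤ _ := by linarith
  · exact sq_le_sq' (abs_le.1 (hcb u)).1 (abs_le.1 (hcb u)).2
  · simp [hc1 u hu]

theorem IsUnitPenalty.prod {θ : X → ℝ} {L T : ℝ} (h : IsUnitPenalty θ L T) :
    IsUnitPenalty (fun w : X × X => θ w.1 + θ w.2) (2 * L) (2 * T) where
  differentiable := by
    have := h.differentiable
    fun_prop
  norm_fderiv_le w := by
    have h1 : HasFDerivAt (fun w : X × X => θ w.1 + θ w.2)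
        ((fderiv ℝ θ w.1).comp (.fst ℝ X X) + (fderiv ℝ θ w.2).comp (.snd ℝ X X)) w :=
      ((h.differentiable w.1).hasFDerivAt.comp w hasFDerivAt_fst).add
        ((h.differentiable w.2).hasFDerivAt.comp w hasFDerivAt_snd)
    rw [h1.fderiv]
    refine ContinuousLinearMap.opNorm_le_bound _ ?_ fun v => ?_
    · linarith [norm_nonneg (fderiv ℝ θ w.1), h.norm_fderiv_le w.1]
    · have e1 := (fderiv ℝ θ w.1).le_of_opNorm_le_of_le (h.norm_fderiv_le w.1) (norm_fst_le v)
      have e2 := (fderiv ℝ θ w.2).le_of_opNorm_le_of_le (h.norm_fderiv_le w.2) (norm_snd_le v)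
      refine (norm_add_le (fderiv ℝ θ w.1 v.1) (fderiv ℝ θ w.2 v.2)).trans ?_
      linarith
  map_zero := by simp [h.map_zero]
  nonneg w := add_nonneg (h.nonneg _) (h.nonneg _)
  le w := by linarith [h.le w.1, h.le w.2]
  one_le w hw := by
    rw [Prod.norm_def, le_max_iff] at hw
    rcases hw with hw | hw
    · linarith [h.one_le _ hw, h.nonneg w.2]
    · linarith [h.one_le _ hw, h.nonneg w.1]

theorem IsUnitPenalty.hasFDerivAt_rescale {E : Type*} [NormedAddCommGroup E] [NormedSpace ℝ E]
    {θ : E → ℝ} {L T : ℝ} (h : IsUnitPenalty θ L T) (a r : ℝ) (x u : E) :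
    HasFDerivAt (fun u => a * θ (r • (u - x))) ((a * r) • fderiv ℝ θ (r • (u - x))) u := by
  have h1 : HasFDerivAt (fun u => r • (u - x)) (r • ContinuousLinearMap.id ℝ E) u :=
    ((hasFDerivAt_id u).sub_const x).const_smul r
  have h2 := ((h.differentiable (r • (u - x))).hasFDerivAt.comp u h1).const_mul a
  refine h2.congr_fderiv ?_
  ext v
  simp [mul_assoc]

/-- Smooth variational principle of Deville–Godefroy–Zizler type. -/
theorem IsUnitPenalty.exists_perturbed_min {E : Type*} [NormedAddCommGroup E] [NormedSpace ℝ E]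
    [CompleteSpace E] {θ : E → ℝ} {L T : ℝ} (hL : 0 < L) (hT : 0 < T) (hθ : IsUnitPenalty θ L T)
    {D : Set E} (hD : IsClosed D) (hne : D.Nonempty) {F : E → ℝ} (hF : LowerSemicontinuousOn F D)
    {m : ℝ} (hm : ∀ y ∈ D, m ≤ F y) {ε : ℝ} (hε : 0 < ε) :
    ∃ p : E → ℝ, Differentiable ℝ p ∧ (∀ u, ‖fderiv ℝ p u‖ ≤ ε) ∧ (∀ u, 0 ≤ p u) ∧
      (∀ u, p u ≤ ε) ∧ ∃ x ∈ D, ∀ y ∈ D, F x + p x ≤ F y + p y := by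
  obtain ⟨c, hc0, hcT, hcL⟩ : ∃ c > 0, 2 * (c * T) ≤ ε ∧ 2 * (c * L) ≤ ε := by
    refine ⟨ε / (2 * (L + T)), by positivity, ?_, ?_⟩ <;>
    · rw [div_mul_eq_mul_div, ← mul_div_assoc, div_le_iff₀ (by positivity)]
      nlinarith
  have hsel : ∀ (G : E → ℝ) (η : ℝ), ∃ x ∈ D, 0 < η → (∀ y ∈ D, m ≤ G y) →
      ∀ y ∈ D, G x ≤ G y + η := by
    intro G η
    by_cases h : 0 < η ∧ ∀ y ∈ D, m ≤ G y
    · have hb : BddBelow (G '' D) := ⟨m, by rintro _ ⟨y, hy, rfl⟩; exact h.2 y hy⟩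
      obtain ⟨_, ⟨x, hx, rfl⟩, hlt⟩ := exists_lt_of_csInf_lt (hne.image G)
        (lt_add_of_pos_right (sInf (G '' D)) h.1)
      refine ⟨x, hx, fun _ _ y hy => ?_⟩
      linarith [csInf_le hb (Set.mem_image_of_mem G hy)]
    · obtain ⟨x, hx⟩ := hne
      exact ⟨x, hx, fun h1 h2 => absurd ⟨h1, h2⟩ h⟩
  choose sel hselD hsel using hsel
  set a : ℕ → ℝ := fun n => c * (1 / 4) ^ n with ha
  have ha0 : ∀ n, 0 < a n := fun n => by positivity
  let G : ℕ → E → ℝ := fun n => Nat.rec F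
    (fun n g u => g u + a n * θ ((2 : ℝ) ^ n • (u - sel g (a n / 2)))) n
  set x : ℕ → E := fun n => sel (G n) (a n / 2) with hx
  set q : ℕ → E → ℝ := fun n u => a n * θ ((2 : ℝ) ^ n • (u - x n)) with hq
  have hGs : ∀ n u, G (n + 1) u = G n u + q n u := fun n u => rfl
  have hxD : ∀ n, x n ∈ D := fun n => hselD _ _
  have hq0 : ∀ n u, 0 ≤ q n u := fun n u => mul_nonneg (ha0 n).le (hθ.nonneg _)
  have hqle : ∀ n u, q n u ≤ c * T * (1 / 4) ^ n := fun n u => by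
    have := mul_le_mul_of_nonneg_left (hθ.le ((2 : ℝ) ^ n • (u - x n))) (ha0 n).le
    calc q n u ≤ a n * T := this
      _ = _ := by simp only [ha]; ring
  have hGsum : ∀ n u, G n u = F u + ∑ k ∈ Finset.range n, q k u := by
    intro n u
    induction n with
    | zero => simp [G]
    | succ n ih => rw [hGs, ih, Finset.sum_range_succ, add_assoc]
  have hGm : ∀ n, ∀ y ∈ D, m ≤ G n y := fun n y hy => by
    rw [hGsum]
    linarith [hm y hy, Finset.sum_nonneg fun k (_ : k ∈ Finset.range n) => hq0 k y]
  have hmin : ∀ n, ∀ y ∈ D, G n (x n) ≤ G n y + a n / 2 := fun n =>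
    hsel _ _ (half_pos (ha0 n)) (hGm n)
  have hstep : ∀ n, dist (x n) (x (n + 1)) ≤ 1 * (1 / 2) ^ n := by
    intro n
    by_contra! hlt
    have h1 : 1 ≤ ‖(2 : ℝ) ^ n • (x (n + 1) - x n)‖ := by
      rw [norm_smul, norm_pow, Real.norm_ofNat, ← dist_eq_norm, dist_comm]
      have : (2 : ℝ) ^ n * (1 * (1 / 2) ^ n) = 1 := by
        rw [one_mul, ← mul_pow]
        norm_num
      rw [← this]
      gcongr
    have h2 : a n ≤ q n (x (n + 1)) := le_mul_of_one_le_right (ha0 n).le (hθ.one_le _ h1)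
    have h3 : q n (x n) = 0 := by simp [hq, hθ.map_zero]
    have h4 := hmin (n + 1) _ (hxD n)
    have h5 := hmin n _ (hxD (n + 1))
    rw [hGs, hGs, h3] at h4
    have h6 : a (n + 1) = a n / 4 := by
      simp only [ha, pow_succ]
      ring
    linarith [ha0 n]
  obtain ⟨xb, hxb⟩ := cauchySeq_tendsto_of_complete
    (cauchySeq_of_le_geometric (1 / 2) 1 (by norm_num) hstep)
  have hxbD : xb ∈ D := hD.mem_of_tendsto hxb (Eventually.of_forall hxD)
  have hqd : ∀ n u, HasFDerivAt (q n) ((a n * 2 ^ n) • fderiv ℝ θ ((2 : ℝ) ^ n • (u - x n))) u :=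
    fun n u => hθ.hasFDerivAt_rescale _ _ _ _
  have hqd' : ∀ n u, ‖(a n * 2 ^ n) • fderiv ℝ θ ((2 : ℝ) ^ n • (u - x n))‖
      ≤ c * L * (1 / 2) ^ n := by
    intro n u
    have h1 : a n * 2 ^ n = c * (1 / 2) ^ n := by
      simp only [ha]
      rw [mul_assoc, ← mul_pow]
      norm_num
    rw [h1, norm_smul, Real.norm_of_nonneg (by positivity)]
    calc _ ≤ c * (1 / 2) ^ n * L := by
          gcongr
          exact hθ.norm_fderiv_le _
      _ = _ := by ring
  have hgeo2 : HasSum (fun n : ℕ => c * L * (1 / 2 : ℝ) ^ n) (c * L * 2) :=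
    hasSum_geometric_two.mul_left _
  have hgeo4 : ∀ n : ℕ, HasSum (fun k : ℕ => c * T * (1 / 4 : ℝ) ^ (k + n))
      (c * T * (4 / 3) * (1 / 4) ^ n) := fun n => by
    have := (hasSum_geometric_of_lt_one (r := (1 / 4 : ℝ)) (by norm_num) (by norm_num)).mul_left
      (c * T * (1 / 4) ^ n)
    rw [show c * T * (4 / 3) * (1 / 4) ^ n = c * T * (1 / 4) ^ n * (1 - 1 / 4)⁻¹ by norm_num; ring]
    refine this.congr_fun fun k => ?_
    ring
  have hqs : ∀ u, Summable fun n => q n u := fun u =>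
    Summable.of_nonneg_of_le (hq0 · u) (hqle · u) (by simpa using (hgeo4 0).summable)
  set p : E → ℝ := fun u => ∑' n, q n u with hp
  have hpd : ∀ u, HasFDerivAt p
      (∑' n, (a n * 2 ^ n) • fderiv ℝ θ ((2 : ℝ) ^ n • (u - x n))) u := fun u =>
    hasFDerivAt_tsum hgeo2.summable hqd hqd' (hqs xb) u
  have htail : ∀ n u, p u ≤ (∑ k ∈ Finset.range n, q k u) + c * T * (4 / 3) * (1 / 4) ^ n := by
    intro n u
    simp only [hp]
    rw [← (hqs u).sum_add_tsum_nat_add n]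
    gcongr
    rw [← (hgeo4 n).tsum_eq]
    exact ((summable_nat_add_iff n).2 (hqs u)).tsum_le_tsum (fun k => hqle _ _) (hgeo4 n).summable
  have hhead : ∀ n u, (∑ k ∈ Finset.range n, q k u) ≤ p u := fun n u =>
    (hqs u).sum_le_tsum _ fun k _ => hq0 k u
  refine ⟨p, fun u => (hpd u).differentiableAt, fun u => ?_, fun u => tsum_nonneg (hq0 · u),
    fun u => ?_, xb, hxbD, fun y hy => ?_⟩
  · rw [(hpd u).fderiv]
    have := tsum_of_norm_bounded hgeo2 (hqd' · u)
    linarith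
  · have := htail 0 u
    simp only [Finset.range_zero, Finset.sum_empty, pow_zero] at this
    nlinarith [mul_pos hc0 hT]
  · have hpc : Continuous p := continuous_iff_continuousAt.2 fun u => (hpd u).continuousAt
    have hlsc : LowerSemicontinuousOn (fun u => F u + p u) D :=
      hF.add (hpc.lowerSemicontinuous.lowerSemicontinuousOn D)
    have hxb' : Tendsto x atTop (𝓝[D] xb) :=
      tendsto_nhdsWithin_iff.2 ⟨hxb, Eventually.of_forall hxD⟩
    have hlim : Tendsto (fun n : ℕ => F y + p y + (c / 2 + c * T * (4 / 3)) * (1 / 4 : ℝ) ^ n) atTop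
        (𝓝 (F y + p y + (c / 2 + c * T * (4 / 3)) * 0)) :=
      ((tendsto_pow_atTop_nhds_zero_of_lt_one (by norm_num) (by norm_num)).const_mul _).const_add _
    rw [mul_zero, add_zero] at hlim
    refine le_of_forall_lt fun e he => ?_
    obtain ⟨e', he, he'⟩ := exists_between he
    refine he.trans_le (ge_of_tendsto hlim ?_)
    filter_upwards [hxb'.eventually (hlsc xb hxbD e' he')] with n hn
    have h1 := htail n (x n)
    have h2 := hhead n y
    have h3 := hmin n y hy
    rw [hGsum, hGsum] at h3
    have h4 : a n = c * (1 / 4) ^ n := rfl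
    linarith

theorem neg_mem_subdiff_of_isLocalMin_add {f q : X → ℝ} {q' : X →L[ℝ] ℝ} {y : X}
    (hq : HasFDerivAt q q' y) (hmin : IsLocalMin (fun u => f u + q u) y) :
    -q' ∈ subdiff f y := by
  intro e he
  have h1 := hq.isLittleO.def he
  obtain ⟨δ, hδ, hball⟩ := Metric.eventually_nhds_iff.1 (h1.and hmin)
  refine ⟨δ, hδ, fun h hh => ?_⟩
  obtain ⟨h2, h3⟩ := hball (y := y + h) (by simpa using hh)
  rw [add_sub_cancel_left, Real.norm_eq_abs] at h2
  have := (abs_le.1 h2).2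
  simp only [neg_apply]
  linarith

theorem stmt4 [CompleteSpace X] (hbump : HasC1LipBump X)
    (f g : X → ℝ) (hf : LowerSemicontinuous f)
    (hg : ∀ x : X, ∃ U ∈ 𝓝 x, UniformContinuousOn g U)
    (x : X) (Δ : X →L[ℝ] ℝ) (hΔ : Δ ∈ subdiff (fun y => f y + g y) x)
    (ε : ℝ) (hε : 0 < ε) :
    ∃ (x₁ x₂ : X) (Δ₁ Δ₂ : X →L[ℝ] ℝ),
      Δ₁ ∈ subdiff f x₁ ∧ Δ₂ ∈ subdiff g x₂ ∧
      ‖x₁ - x‖ < ε ∧ ‖x₂ - x‖ < ε ∧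
      |f x₁ - f x| < ε ∧ |g x₂ - g x| < ε ∧
      ‖Δ₁ + Δ₂ - Δ‖ < ε ∧
      ‖x₁ - x₂‖ * max ‖Δ₁‖ ‖Δ₂‖ < ε := by
  obtain ⟨θ, L, T, hL, hT, hθ⟩ := hbump.exists_isUnitPenalty
  obtain ⟨U, hU, hgU⟩ := hg x
  set s : ℝ := ε / (16 * L) with hs
  have hs0 : 0 < s := by positivity
  have hsL : 4 * s * L = ε / 4 := by
    rw [hs]
    field_simp
    norm_num
  obtain ⟨δ, hδ, hsub⟩ := hΔ s hs0
  have hgc : ContinuousAt g x := hgU.continuousOn.continuousAt hU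
  have hgx : ∀ᶠ u in 𝓝 x, |g u - g x| < ε / 4 := by
    simpa [Real.dist_eq] using Metric.continuousAt_iff'.1 hgc (ε / 4) (by positivity)
  obtain ⟨ρ, hρ, hball⟩ := Metric.eventually_nhds_iff.1
    ((show ∀ᶠ u in 𝓝 x, u ∈ U from hU).and (hgx.and (hf x (f x - ε) (by linarith))))
  simp only [dist_eq_norm] at hball
  obtain ⟨t, ht0, htδ, htρ, ht1, htε, hts, htΔ⟩ : ∃ t : ℝ, 0 < t ∧ t < δ ∧ 2 * t < ρ ∧ t ≤ 1 ∧
      2 * t < ε ∧ s * t ≤ ε / 4 ∧ t * (‖Δ‖ + ε) ≤ ε / 4 := by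
    have hev : ∀ C b : ℝ, 0 < b → ∀ᶠ t : ℝ in 𝓝[>] 0, C * t < b := fun C b hb => by
      refine (ContinuousAt.eventually_lt (f := fun t => C * t) (g := fun _ => b) (by fun_prop)
        continuousAt_const (by simpa using hb)).filter_mono nhdsWithin_le_nhds
    obtain ⟨t, h0, h1, h2, h3, h4, h5, h6⟩ := ((eventually_mem_nhdsWithin (a := (0 : ℝ)) (s := Set.Ioi 0)).and <| (hev 1 δ hδ).and <|
      (hev 2 ρ hρ).and <| (hev 1 1 one_pos).and <| (hev 2 ε hε).and <|
      (hev s (ε / 4) (by positivity)).and (hev (‖Δ‖ + ε) (ε / 4) (by positivity))).exists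
    exact ⟨t, h0, by linarith, h2, by linarith, h4, h5.le, by linarith⟩
  set η : ℝ := s * t with hη
  have hη0 : 0 < η := by positivity
  obtain ⟨σ₀, hσ₀, hσg⟩ := Metric.uniformContinuousOn_iff.1 hgU η hη0
  simp only [dist_eq_norm, Real.norm_eq_abs] at hσg
  obtain ⟨σ, hσ0, hσσ, hσt⟩ : ∃ σ : ℝ, 0 < σ ∧ σ < σ₀ ∧ σ ≤ t :=
    ⟨min (σ₀ / 2) t, by positivity, (min_le_left _ _).trans_lt (by linarith), min_le_right _ _⟩
  set D : Set (X × X) := {w | ‖w.1 - x‖ ≤ t ∧ ‖w.1 - w.2‖ ≤ σ} with hD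
  have hDc : IsClosed D :=
    (isClosed_le (f := fun w : X × X => ‖w.1 - x‖) (by fun_prop) continuous_const).inter
      (isClosed_le (f := fun w : X × X => ‖w.1 - w.2‖) (by fun_prop) continuous_const)
  have hD2 : ∀ w ∈ D, ‖w.2 - x‖ ≤ 2 * t := fun w hw => by
    have := norm_sub_le_norm_sub_add_norm_sub w.2 w.1 x
    rw [norm_sub_rev w.2 w.1] at this
    linarith [hw.1, hw.2]
  have hD1U : ∀ w ∈ D, w.1 ∈ U := fun w hw => (hball (by linarith [hw.1])).1
  have hD2U : ∀ w ∈ D, w.2 ∈ U := fun w hw => (hball (by linarith [hD2 w hw])).1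
  have hxD : (x, x) ∈ D := by simp [hD, ht0.le, hσ0.le]
  set A : X × X → ℝ := fun w => 4 * η * θ (t⁻¹ • (w.1 - x)) with hA
  set B : X × X → ℝ := fun w => 4 * η * θ (σ⁻¹ • (w.1 - w.2)) with hB
  have hA0 : ∀ w, 0 ≤ A w := fun w => mul_nonneg (by positivity) (hθ.nonneg _)
  have hB0 : ∀ w, 0 ≤ B w := fun w => mul_nonneg (by positivity) (hθ.nonneg _)
  set F : X × X → ℝ := fun w => f w.1 + (g w.2 + (-Δ (w.1 - x) + A w + B w)) with hFdef
  have hF : LowerSemicontinuousOn F D := by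
    have hθc := hθ.differentiable.continuous
    refine (hf.comp continuous_fst).lowerSemicontinuousOn D |>.add
      (ContinuousOn.lowerSemicontinuousOn ?_)
    refine (hgU.continuousOn.comp continuousOn_snd hD2U).add (Continuous.continuousOn ?_)
    simp only [hA, hB]
    fun_prop
  have hFlow : ∀ w ∈ D, f x + g x - 2 * η + A w + B w ≤ F w := by
    intro w hw
    have h1 := hsub (w.1 - x) (hw.1.trans_lt htδ)
    rw [add_sub_cancel] at h1
    have h2 := abs_lt.1 (hσg _ (hD1U w hw) _ (hD2U w hw) (hw.2.trans_lt hσσ))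
    have h3 : s * ‖w.1 - x‖ ≤ η := by
      rw [hη]
      gcongr
      exact hw.1
    simp only [hFdef]
    linarith
  have hFx : F (x, x) = f x + g x := by simp [hFdef, hA, hB, hθ.map_zero]
  obtain ⟨p, hpd, hp', hp0, hpη, ⟨y, z⟩, hwD, hwmin⟩ := hθ.prod.exists_perturbed_min
    (by positivity) (by positivity) hDc ⟨_, hxD⟩ hF (m := f x + g x - 2 * η)
    (fun w hw => by linarith [hFlow w hw, hA0 w, hB0 w]) (ε := min η (ε / 16)) (by positivity)
  have hFw : F (y, z) ≤ f x + g x + η := by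
    linarith [hwmin _ hxD, hp0 (y, z), hpη (x, x), min_le_left η (ε / 16)]
  have hlow := hFlow _ hwD
  have hyx : ‖y - x‖ < t := by
    by_contra! hle
    have : 1 ≤ θ (t⁻¹ • (y - x)) := hθ.one_le _ (by
      rw [norm_smul, norm_inv, Real.norm_of_nonneg ht0.le, ← div_eq_inv_mul]
      exact (one_le_div ht0).2 hle)
    have : 4 * η ≤ A (y, z) := le_mul_of_one_le_right (by positivity) this
    linarith [hB0 (y, z)]
  have hyz : ‖y - z‖ < σ := by
    by_contra! hle
    have : 1 ≤ θ (σ⁻¹ • (y - z)) := hθ.one_le _ (by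
      rw [norm_smul, norm_inv, Real.norm_of_nonneg hσ0.le, ← div_eq_inv_mul]
      exact (one_le_div hσ0).2 hle)
    have : 4 * η ≤ B (y, z) := le_mul_of_one_le_right (by positivity) this
    linarith [hA0 (y, z)]
  have hzx := hD2 _ hwD
  have hDn : D ∈ 𝓝 (y, z) := by
    have h1 : ∀ᶠ w : X × X in 𝓝 (y, z), ‖w.1 - x‖ < t :=
      ContinuousAt.eventually_lt (by fun_prop) continuousAt_const hyx
    have h2 : ∀ᶠ w : X × X in 𝓝 (y, z), ‖w.1 - w.2‖ < σ :=
      ContinuousAt.eventually_lt (by fun_prop) continuousAt_const hyz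
    filter_upwards [h1, h2] with w h1 h2 using ⟨h1.le, h2.le⟩
  set P := fderiv ℝ p (y, z) with hP
  have hPn : ‖P‖ ≤ ε / 16 := (hp' _).trans (min_le_right _ _)
  set P₁ := P.comp (.inl ℝ X X) with hP₁
  set P₂ := P.comp (.inr ℝ X X) with hP₂
  have hP₁n : ‖P₁‖ ≤ ε / 16 := by
    refine ContinuousLinearMap.opNorm_le_bound _ (by positivity) fun v => ?_
    simpa [hP₁, Prod.norm_def] using P.le_of_opNorm_le hPn (v, (0 : X))
  have hP₂n : ‖P₂‖ ≤ ε / 16 := by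
    refine ContinuousLinearMap.opNorm_le_bound _ (by positivity) fun v => ?_
    simpa [hP₂, Prod.norm_def] using P.le_of_opNorm_le hPn ((0 : X), v)
  set A' := (4 * η * t⁻¹) • fderiv ℝ θ (t⁻¹ • (y - x)) with hA'
  set B' := (4 * η * σ⁻¹) • fderiv ℝ θ (σ⁻¹ • (y - z)) with hB'
  have hA'n : ‖A'‖ ≤ ε / 4 := by
    have h1 : 4 * η * t⁻¹ = 4 * s := by
      rw [hη]
      field_simp
    rw [hA', norm_smul, Real.norm_of_nonneg (by positivity), ← hsL, h1]
    gcongr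
    exact hθ.norm_fderiv_le _
  have hB'n : σ * ‖B'‖ ≤ ε / 4 := by
    have h1 : σ * (4 * η * σ⁻¹) ≤ 4 * s :=
      calc σ * (4 * η * σ⁻¹) = 4 * s * t := by rw [hη]; field_simp
        _ ≤ 4 * s := mul_le_of_le_one_right (by positivity) ht1
    rw [hB', norm_smul, Real.norm_of_nonneg (by positivity), ← mul_assoc, ← hsL]
    exact mul_le_mul h1 (hθ.norm_fderiv_le _) (norm_nonneg _) (by positivity)
  have hq₁ : HasFDerivAt (fun u => g z + (-Δ (u - x) + A (u, z) + B (u, z)) + p (u, z))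
      (-Δ + A' + B' + P₁) y := by
    refine HasFDerivAt.add (.const_add _ (.add (.add ?_ ?_) ?_)) ?_
    · exact (Δ.hasFDerivAt.comp y ((hasFDerivAt_id y).sub_const x)).neg
    · exact hθ.hasFDerivAt_rescale _ _ _ _
    · exact hθ.hasFDerivAt_rescale _ _ _ _
    · exact (hpd (y, z)).hasFDerivAt.comp y (hasFDerivAt_prodMk_left y z)
  have hq₂ : HasFDerivAt (fun u => f y + (-Δ (y - x) + A (y, u) + B (y, u)) + p (y, u))
      (-B' + P₂) z := by
    refine HasFDerivAt.add
      (.const_add _ (.const_add (-Δ (y - x) + 4 * η * θ (t⁻¹ • (y - x))) ?_)) ?_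
    · have h1 : HasFDerivAt (fun u => σ⁻¹ • (y - u)) (-(σ⁻¹ • ContinuousLinearMap.id ℝ X)) z := by
        rw [← smul_neg]
        exact ((hasFDerivAt_id z).const_sub y).const_smul σ⁻¹
      refine ((hθ.differentiable _).hasFDerivAt.comp z h1).const_mul (4 * η) |>.congr_fderiv ?_
      ext v
      simp [hB', mul_assoc]
    · exact (hpd (y, z)).hasFDerivAt.comp z (hasFDerivAt_prodMk_right y z)
  have hΔ₁ : -(-Δ + A' + B' + P₁) ∈ subdiff f y := by
    refine neg_mem_subdiff_of_isLocalMin_add hq₁ ?_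
    have hc : Tendsto (fun u => (u, z)) (𝓝 y) (𝓝 (y, z)) :=
      (Continuous.prodMk_left z).tendsto y
    filter_upwards [hc.eventually hDn] with u hu
    have := hwmin (u, z) hu
    simp only [hFdef] at this
    linarith
  have hΔ₂ : -(-B' + P₂) ∈ subdiff g z := by
    refine neg_mem_subdiff_of_isLocalMin_add hq₂ ?_
    have hc : Tendsto (fun u => (y, u)) (𝓝 z) (𝓝 (y, z)) :=
      (Continuous.prodMk_right y).tendsto z
    filter_upwards [hc.eventually hDn] with u hu
    have := hwmin (y, u) hu
    simp only [hFdef] at this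
    linarith
  have hgz : |g z - g x| < ε / 4 := (hball (by linarith)).2.1
  refine ⟨y, z, _, _, hΔ₁, hΔ₂, by linarith, by linarith, ?_, by linarith, ?_, ?_⟩
  · have h1 : f x - ε < f y := (hball (by linarith)).2.2
    have h2 : |Δ (y - x)| ≤ ‖Δ‖ * t := Δ.le_of_opNorm_le_of_le le_rfl hyx.le
    have h3 := abs_lt.1 hgz
    have h4 := abs_le.1 h2
    have h5 := hA0 (y, z)
    have h6 := hB0 (y, z)
    simp only [hFdef] at hFw
    rw [abs_lt]
    constructor
    · linarith
    · nlinarith [mul_pos ht0 hε]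
  · have : -(-Δ + A' + B' + P₁) + -(-B' + P₂) - Δ = -(A' + P₁ + P₂) := by abel
    rw [this, norm_neg]
    linarith [norm_add₃_le (a := A') (b := P₁) (c := P₂)]
  · have h2 : ‖-(-B' + P₂)‖ ≤ ‖B'‖ + ε / 16 := by
      rw [norm_neg]
      have := norm_add_le (-B') P₂
      rw [norm_neg] at this
      linarith
    have h1 : ‖-(-Δ + A' + B' + P₁)‖ ≤ ‖Δ‖ + ε / 2 + ‖B'‖ := by
      rw [norm_neg]
      have e1 := norm_add_le (-Δ + A' + B') P₁
      have e2 := norm_add₃_le (a := -Δ) (b := A') (c := B')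
      rw [norm_neg] at e2
      linarith
    have h3 : max ‖-(-Δ + A' + B' + P₁)‖ ‖-(-B' + P₂)‖ ≤ ‖Δ‖ + ε + ‖B'‖ :=
      max_le (by linarith) (by linarith [norm_nonneg Δ])
    calc _ ≤ σ * (‖Δ‖ + ε + ‖B'‖) := by gcongr
      _ = σ * (‖Δ‖ + ε) + σ * ‖B'‖ := by ring
      _ ≤ t * (‖Δ‖ + ε) + σ * ‖B'‖ := by gcongr
      _ < ε := by linarith
end

section
/- Let X be a real Banach space admitting a C¹ Lipschitz bump function. If f : X → (−∞,+∞] is proper and lower semicontinuous, then the set of points x ∈ dom(f) at which D⁻f(x) ≠ ∅ is dense in dom(f) = {y ∈ X : f(y) < +∞}. -/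
open Filter Topology

variable {X : Type*} [NormedAddCommGroup X] [NormedSpace ℝ X]

/-- The Fréchet subdifferential of an extended-real-valued function `f` at `x`. -/
def erealSubdiff (f : X → EReal) (x : X) : Set (X →L[ℝ] ℝ) :=
  {Δ | ∀ ε > (0:ℝ), ∃ δ > (0:ℝ), ∀ h : X, ‖h‖ < δ →
    f x + ((Δ h - ε * ‖h‖ : ℝ) : EReal) ≤ f (x + h)}

/-- A `C¹` Lipschitz bump can be normalized: nonnegative, bounded with bounded derivative, equal to
`1` at the origin and vanishing outside the unit ball. -/
theorem HasC1LipBump.exists_normalized (h : HasC1LipBump X) :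
    ∃ (b : X → ℝ) (M L : ℝ), Differentiable ℝ b ∧ (∀ x, ‖fderiv ℝ b x‖ ≤ L) ∧ (∀ x, 0 ≤ b x) ∧
      (∀ x, b x ≤ M) ∧ b 0 = 1 ∧ ∀ x, 1 < ‖x‖ → b x = 0 := by
  obtain ⟨β, hβ, ⟨K, hK⟩, hbdd, a, ha⟩ := h
  have ha : β a ≠ 0 := ha
  have hdiff : Differentiable ℝ β := hβ.differentiable (by norm_num)
  obtain ⟨R, hR⟩ := hbdd.exists_norm_le
  have hR : ∀ x, β x ≠ 0 → ‖x‖ ≤ R := fun x hx => hR x hx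
  have hR0 : 0 ≤ R := (norm_nonneg a).trans (hR a ha)
  set C : ℝ := |β a| + K * (2 * R) with hC
  have hC0 : 0 ≤ C := by positivity
  have hbound : ∀ x, |β x| ≤ C := by
    intro x
    by_cases hx : β x = 0
    · simpa [hx] using hC0
    have h1 := hK.dist_le_mul x a
    have h2 : dist x a ≤ 2 * R := by
      rw [dist_eq_norm]
      linarith [norm_sub_le x a, hR x hx, hR a ha]
    have h3 : (K : ℝ) * dist x a ≤ K * (2 * R) := by gcongr
    have h4 : |β x| - |β a| ≤ |β x - β a| := abs_sub_abs_le_abs_sub _ _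
    rw [Real.dist_eq] at h1
    linarith
  set s : ℝ := R + ‖a‖ + 1 with hs
  have hs0 : 0 < s := by positivity
  have hd : ∀ x, HasFDerivAt (fun x : X => (β (a + s • x) / β a) ^ 2)
      ((2 * (β (a + s • x) / β a) * ((β a)⁻¹ * s)) • fderiv ℝ β (a + s • x)) x := by
    intro x
    have h1 : HasFDerivAt (fun x : X => a + s • x) (s • ContinuousLinearMap.id ℝ X) x :=
      ((hasFDerivAt_id x).const_smul s).const_add a
    have h2 := ((hdiff (a + s • x)).hasFDerivAt.comp x h1)
    have h3 := (h2.mul_const (β a)⁻¹).pow 2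
    refine (h3.congr_fderiv ?_).congr_of_eventuallyEq (.of_forall fun y => ?_)
    · ext v
      simp [div_eq_mul_inv]
      ring
    · simp [div_eq_mul_inv]
  refine ⟨fun x => (β (a + s • x) / β a) ^ 2, (C / |β a|) ^ 2,
    2 * (C / |β a|) * (|β a|⁻¹ * s) * K, fun x => (hd x).differentiableAt, fun x => ?_,
    fun x => by positivity, fun x => ?_, by simp [ha], fun x hx => ?_⟩
  · rw [(hd x).fderiv, norm_smul]
    have := norm_fderiv_le_of_lipschitz ℝ hK (x₀ := a + s • x)
    simp only [norm_mul, norm_div, norm_inv, Real.norm_eq_abs, abs_of_pos hs0, abs_two]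
    gcongr
    exact hbound _
  · change (β (a + s • x) / β a) ^ 2 ≤ _
    rw [← sq_abs, abs_div]
    gcongr
    exact hbound _
  · have : β (a + s • x) = 0 := by
      by_contra hne
      have h1 := hR _ hne
      have h2 : ‖s • x‖ ≤ ‖a + s • x‖ + ‖a‖ := by
        simpa using norm_sub_le (a + s • x) a
      rw [norm_smul, Real.norm_eq_abs, abs_of_pos hs0] at h2
      nlinarith
    simp [this]

/-- Iterated near-minimization: at each step a bump, scaled and centred at a near-minimizer of the
current function, is subtracted. -/
theorem exists_seq_nearMin {S : Set X} {F : X → ℝ} {m : ℝ} (hF : ∀ y ∈ S, m ≤ F y)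
    {x₀ : X} (hx₀ : x₀ ∈ S) {b : X → ℝ} {M : ℝ} (hbM : ∀ x, b x ≤ M)
    {δ : ℕ → ℝ} (hδ : ∀ n, 0 < δ n) (r : ℕ → ℝ) (h₀ : F x₀ ≤ m + δ 0 / 2) :
    ∃ x : ℕ → X, x 0 = x₀ ∧ ∀ n, x n ∈ S ∧ ∀ y ∈ S,
      F (x n) - ∑ i ∈ Finset.range n, δ i * b ((r i)⁻¹ • (x n - x i)) ≤
        F y - ∑ i ∈ Finset.range n, δ i * b ((r i)⁻¹ • (y - x i)) + δ n / 2 := by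
  have key : ∀ (n : ℕ) (g : X → ℝ), ∃ x, (∃ C, ∀ y, g y ≤ C) →
      (x ∈ S ∧ ∀ y ∈ S, F x - g x ≤ F y - g y + δ n / 2) ∧
      ((∀ y ∈ S, F x₀ - g x₀ ≤ F y - g y + δ n / 2) → x = x₀) := by
    intro n g
    by_cases h : ∀ y ∈ S, F x₀ - g x₀ ≤ F y - g y + δ n / 2
    · exact ⟨x₀, fun _ => ⟨⟨hx₀, h⟩, fun _ => rfl⟩⟩
    by_cases hC : ∃ C, ∀ y, g y ≤ C
    swap
    · exact ⟨x₀, fun h' => absurd h' hC⟩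
    obtain ⟨C, hC⟩ := hC
    have hbdd : BddBelow ((fun y => F y - g y) '' S) := by
      refine ⟨m - C, ?_⟩
      rintro _ ⟨y, hy, rfl⟩
      linarith [hF y hy, hC y]
    obtain ⟨_, ⟨x, hx, rfl⟩, hlt⟩ := exists_lt_of_csInf_lt
      (Set.Nonempty.image (fun y => F y - g y) ⟨x₀, hx₀⟩)
      (lt_add_of_pos_right _ (half_pos (hδ n)))
    refine ⟨x, fun _ => ⟨⟨hx, fun y hy => ?_⟩, fun h' => absurd h' h⟩⟩
    have := csInf_le hbdd ⟨y, hy, rfl⟩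
    linarith
  choose pick hpick using key
  let g : ℕ → X → ℝ := fun n => Nat.rec (fun _ => 0)
    (fun n g y => g y + δ n * b ((r n)⁻¹ • (y - pick n g))) n
  have hg : ∀ n y, g n y =
      ∑ i ∈ Finset.range n, δ i * b ((r i)⁻¹ • (y - pick i (g i))) := by
    intro n y
    induction n with
    | zero => simp [g]
    | succ n ih => rw [Finset.sum_range_succ, ← ih]
  have hgC : ∀ n, ∃ C, ∀ y, g n y ≤ C := by
    refine fun n => ⟨∑ i ∈ Finset.range n, δ i * M, fun y => ?_⟩
    rw [hg]
    exact Finset.sum_le_sum fun i _ => mul_le_mul_of_nonneg_left (hbM _) (hδ i).le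
  refine ⟨fun n => pick n (g n), (hpick 0 (g 0) (hgC 0)).2 fun y hy => ?_, fun n => ?_⟩
  · simp only [hg, Finset.range_zero, Finset.sum_empty]
    linarith [hF y hy]
  · simpa only [hg n] using (hpick n (g n) (hgC n)).1

/-- A smooth variational principle: a function bounded below on `S` admits a differentiable
perturbation with a convergent minimizing sequence in `S`. -/
theorem exists_differentiable_perturbation [CompleteSpace X] (hbump : HasC1LipBump X)
    {S : Set X} {F : X → ℝ} {m : ℝ} (hF : ∀ y ∈ S, m ≤ F y)
    {x₀ : X} (hx₀ : x₀ ∈ S) {ρ : ℝ} (hρ : 0 < ρ) :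
    ∃ (z : X) (g : X → ℝ) (x : ℕ → X) (η : ℕ → ℝ), dist x₀ z ≤ ρ ∧ Differentiable ℝ g ∧
      Tendsto x atTop (𝓝 z) ∧ Tendsto η atTop (𝓝 0) ∧
      ∀ n, x n ∈ S ∧ ∀ y ∈ S, F (x n) - g (x n) ≤ F y - g y + η n := by
  obtain ⟨b, M, L, hb, hL, hb0, hbM, hb1, hbs⟩ := hbump.exists_normalized
  have hM : 1 ≤ M := hb1 ▸ hbM 0
  set d : ℝ := 2 * (F x₀ - m) + 1 with hd
  have hd0 : 0 < d := by linarith [hF x₀ hx₀]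
  set q : ℝ := (8 * M)⁻¹ with hq
  have hq0 : 0 < q := by positivity
  have hMq : M * q = 1 / 8 := by rw [hq]; field_simp
  have hq8 : q ≤ 1 / 8 := by nlinarith
  set δ : ℕ → ℝ := fun n => d * q ^ n with hδdef
  set r : ℕ → ℝ := fun n => ρ * (1 / 2) ^ n with hrdef
  have hδ : ∀ n, 0 < δ n := fun n => by positivity
  have hr : ∀ n, 0 < r n := fun n => by positivity
  have hδ_lim : Tendsto δ atTop (𝓝 0) := by
    simpa using (tendsto_pow_atTop_nhds_zero_of_lt_one hq0.le (by linarith)).const_mul d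
  have hr_lim : Tendsto r atTop (𝓝 0) := by
    simpa [hrdef] using (tendsto_pow_atTop_nhds_zero_of_lt_one
      (by norm_num : (0 : ℝ) ≤ 1 / 2) (by norm_num)).const_mul ρ
  have hδ_sum : Summable δ :=
    (summable_geometric_of_lt_one hq0.le (by linarith)).mul_left d
  obtain ⟨x, hx0, hx⟩ := exists_seq_nearMin hF hx₀ hbM hδ r (by
    simp only [hδdef, pow_zero]; linarith)
  set p : ℕ → X → ℝ := fun n y => δ n * b ((r n)⁻¹ • (y - x n)) with hp
  have hp0 : ∀ n y, 0 ≤ p n y := fun n y => mul_nonneg (hδ n).le (hb0 _)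
  have hpM : ∀ n y, p n y ≤ δ n * M := fun n y => mul_le_mul_of_nonneg_left (hbM _) (hδ n).le
  have hp_sum : ∀ y, Summable fun n => p n y := fun y =>
    (hδ_sum.mul_right M).of_nonneg_of_le (fun n => hp0 n y) (fun n => hpM n y)
  have hp_self : ∀ n, p n (x n) = δ n := fun n => by simp [hp, hb1]
  have hp_far : ∀ n y, r n < dist y (x n) → p n y = 0 := by
    intro n y h
    have : 1 < ‖(r n)⁻¹ • (y - x n)‖ := by
      rw [norm_smul, norm_inv, Real.norm_eq_abs, abs_of_pos (hr n), ← dist_eq_norm,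
        ← div_eq_inv_mul, one_lt_div (hr n)]
      exact h
    simp [hp, hbs _ this]
  set G : ℕ → X → ℝ := fun n y => ∑ i ∈ Finset.range n, p i y with hG
  have hGsucc : ∀ n y, G (n + 1) y = G n y + p n y := fun n y => Finset.sum_range_succ _ _
  have hGmono : ∀ y, Monotone fun n => G n y := fun y =>
    monotone_nat_of_le_succ fun n => by simp only [hGsucc]; linarith [hp0 n y]
  set g : X → ℝ := fun y => ∑' n, p n y with hg
  have hGg : ∀ n y, G n y ≤ g y := fun n y =>
    (hp_sum y).sum_le_tsum _ fun i _ => hp0 i y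
  have hgG : ∀ n y, g y ≤ G n y + 2 * M * δ n := by
    intro n y
    have hq1 : q < 1 := by linarith
    have h1 := (hp_sum y).sum_add_tsum_nat_add n
    have h2 : ∑' k, p (k + n) y ≤ ∑' k, (δ n * M) * q ^ k := by
      refine ((summable_nat_add_iff n).2 (hp_sum y)).tsum_le_tsum (fun k => ?_)
        ((summable_geometric_of_lt_one hq0.le hq1).mul_left _)
      refine (hpM _ _).trans_eq ?_
      simp only [hδdef]
      ring
    rw [tsum_mul_left, tsum_geometric_of_lt_one hq0.le hq1] at h2
    have h3 : (1 - q)⁻¹ ≤ 2 := inv_le_of_inv_le₀ (by norm_num) (by linarith)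
    have h4 : (δ n * M) * (1 - q)⁻¹ ≤ (δ n * M) * 2 :=
      mul_le_mul_of_nonneg_left h3 (mul_nonneg (hδ n).le (by linarith))
    simp only [hg, hG]
    linarith
  have hnear : ∀ n, ∀ y ∈ S, F (x n) - G n (x n) ≤ F y - G n y + δ n / 2 := fun n => (hx n).2
  have hdist : ∀ n k, n ≤ k → dist (x n) (x k) ≤ r n := by
    intro n k hnk
    rcases hnk.eq_or_lt with rfl | hlt
    · simpa using (hr n).le
    by_contra! hfar
    rw [dist_comm] at hfar
    have h1 := hnear k (x n) (hx n).1
    have h2 := hnear n (x k) (hx k).1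
    have h3 := hGg (k + 1) (x k)
    rw [hGsucc, hp_self] at h3
    have h4 : G (n + 1) (x n) ≤ G k (x n) := hGmono (x n) hlt
    rw [hGsucc, hp_self] at h4
    have h5 := hgG (n + 1) (x k)
    rw [hGsucc, hp_far n _ hfar] at h5
    have h6 : 2 * M * δ (n + 1) = δ n / 4 := by
      simp only [hδdef, pow_succ]
      linear_combination 2 * d * q ^ n * hMq
    linarith [hδ n, hδ k]
  obtain ⟨z, hz⟩ := cauchySeq_tendsto_of_complete (cauchySeq_of_le_tendsto_0' r hdist hr_lim)
  refine ⟨z, g, x, fun n => (2 * M + 1) * δ n, ?_, ?_, hz, ?_, fun n => ⟨(hx n).1, ?_⟩⟩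
  · have := le_of_tendsto (tendsto_const_nhds.dist hz)
      (.of_forall fun k => hdist 0 k k.zero_le)
    simpa [hx0, hrdef] using this
  · have hp_deriv : ∀ n y, HasFDerivAt (p n)
        ((δ n * (r n)⁻¹) • fderiv ℝ b ((r n)⁻¹ • (y - x n))) y := by
      intro n y
      have h1 : HasFDerivAt (fun y : X => (r n)⁻¹ • (y - x n))
          ((r n)⁻¹ • ContinuousLinearMap.id ℝ X) y :=
        ((hasFDerivAt_id y).sub_const (x n)).const_smul _
      refine (((hb _).hasFDerivAt.comp y h1).const_mul (δ n)).congr_fderiv ?_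
      ext v
      simp
      ring
    refine differentiable_tsum (u := fun n => d * ρ⁻¹ * L * (2 * q) ^ n) ?_ hp_deriv ?_
    · exact (summable_geometric_of_lt_one (by positivity) (by linarith)).mul_left _
    · intro n y
      have h0 : 0 < δ n * (r n)⁻¹ := mul_pos (hδ n) (inv_pos.2 (hr n))
      rw [norm_smul, Real.norm_eq_abs, abs_of_pos h0]
      refine (mul_le_mul_of_nonneg_left (hL _) h0.le).trans_eq ?_
      simp only [hδdef, hrdef, mul_pow, mul_inv, one_div, inv_pow, inv_inv]
      ring
  · simpa using hδ_lim.const_mul (2 * M + 1)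
  · intro y hy
    have h1 := hnear n y hy
    have h2 := hGg n (x n)
    have h3 := hgG n y
    linarith [hδ n]

theorem stmt5 [CompleteSpace X] (hbump : HasC1LipBump X)
    (f : X → EReal) (hf_bot : ∀ y, f y ≠ ⊥) (hf_proper : ∃ y, f y ≠ ⊤)
    (hlsc : LowerSemicontinuous f) :
    ∀ x : X, f x ≠ ⊤ →
      x ∈ closure {y : X | f y ≠ ⊤ ∧ (erealSubdiff f y).Nonempty} := by
  intro x₀ hx₀
  refine Metric.mem_closure_iff.2 fun ε hε => ?_
  obtain ⟨m, hm⟩ : ∃ m : ℝ, (m : EReal) < f x₀ :=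
    EReal.lt_iff_exists_real_btwn.1 (bot_lt_iff_ne_bot.2 (hf_bot x₀)) |>.imp fun _ h => h.2
  obtain ⟨r, hr, hball⟩ := Metric.eventually_nhds_iff_ball.1 (hlsc x₀ m hm)
  have hF : ∀ y, f y ≠ ⊤ → ((f y).toReal : EReal) = f y :=
    fun y hy => EReal.coe_toReal hy (hf_bot y)
  set ρ : ℝ := min r ε / 2 with hρdef
  have hρ : 0 < ρ := half_pos (lt_min hr hε)
  have hρr : ρ < r := by linarith [min_le_left r ε]
  have hρε : ρ < ε := by linarith [min_le_right r ε]
  obtain ⟨z, g, x, η, hz, hg, hxz, hη, hmin⟩ := exists_differentiable_perturbation hbump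
    (S := {y | f y ≠ ⊤ ∧ y ∈ Metric.ball x₀ r}) (F := fun y => (f y).toReal) (m := m)
    (fun y hy => by
      rw [← EReal.coe_le_coe_iff, hF y hy.1]
      exact (hball y hy.2).le)
    ⟨hx₀, Metric.mem_ball_self hr⟩ hρ
  have hzmin : ∀ y, f y ≠ ⊤ → y ∈ Metric.ball x₀ r →
      f z ≤ (((f y).toReal - g y + g z : ℝ) : EReal) := by
    intro y hy hyr
    refine EReal.ge_of_forall_gt_iff_ge.1 fun c hc => EReal.coe_le_coe_iff.2 ?_
    have hlim : Tendsto (fun n => (f y).toReal - g y + η n + g (x n)) atTop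
        (𝓝 ((f y).toReal - g y + 0 + g z)) :=
      (hη.const_add _).add ((hg.continuous.tendsto z).comp hxz)
    rw [add_zero] at hlim
    refine ge_of_tendsto hlim ?_
    filter_upwards [hxz.eventually (hlsc z c hc)] with n hn
    have h1 := (hmin n).2 y ⟨hy, hyr⟩
    rw [← hF _ (hmin n).1.1, gt_iff_lt, EReal.coe_lt_coe_iff] at hn
    linarith
  have hzt : f z ≠ ⊤ := ne_top_of_le_ne_top (EReal.coe_ne_top _)
    (hzmin x₀ hx₀ (Metric.mem_ball_self hr))
  refine ⟨z, ⟨hzt, fderiv ℝ g z, fun e he => ?_⟩, hz.trans_lt hρε⟩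
  have hzball : Metric.ball x₀ r ∈ 𝓝 z :=
    Metric.isOpen_ball.mem_nhds (by rw [Metric.mem_ball']; exact hz.trans_lt hρr)
  have hev : ∀ᶠ h : X in 𝓝 0, z + h ∈ Metric.ball x₀ r :=
    (continuous_const.add continuous_id).tendsto' (0 : X) z (by simp) |>.eventually hzball
  have hder := (hasFDerivAt_iff_isLittleO_nhds_zero.1 (hg z).hasFDerivAt).def he
  obtain ⟨s, hs, hsball⟩ := Metric.eventually_nhds_iff.1 (hev.and hder)
  refine ⟨s, hs, fun h hh => ?_⟩
  obtain ⟨h1, h2⟩ := hsball (y := h) (by simpa using hh)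
  by_cases hy : f (z + h) = ⊤
  · simp [hy]
  have h3 := hzmin _ hy h1
  rw [← hF z hzt, EReal.coe_le_coe_iff] at h3
  rw [← hF z hzt, ← hF _ hy, ← EReal.coe_add, EReal.coe_le_coe_iff]
  have h4 := (abs_le.1 h2).1
  linarith
end

section
/- Let X be a real Banach space admitting a C¹ Lipschitz bump function and let K ≥ 0. Let f : X → ℝ be a lower semicontinuous function such that ‖ξ‖ ≤ K for every x ∈ X and every ξ ∈ D⁻f(x). Then f is K-Lipschitz, i.e. |f(x) − f(y)| ≤ K‖x − y‖ for all x, y ∈ X. -/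
open Filter Topology

variable {X : Type*} [NormedAddCommGroup X] [NormedSpace ℝ X]

/-- A `C¹` Lipschitz bump yields a differentiable, bounded, Lipschitz gauge that vanishes at the
origin and is at least `1` off the unit ball. -/
lemma HasC1LipBump.exists_gauge (hbump : HasC1LipBump X) :
    ∃ φ : X → ℝ, ∃ N : ℝ, 1 ≤ N ∧ Differentiable ℝ φ ∧ φ 0 = 0 ∧ (∀ z, 0 ≤ φ z) ∧
      (∀ z, φ z ≤ N) ∧ (∀ z, 1 ≤ ‖z‖ → 1 ≤ φ z) ∧ ∀ z w, |φ z - φ w| ≤ N * ‖z - w‖ := by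
  obtain ⟨b, hb, ⟨L, hL⟩, hbdd, x₀, hx₀⟩ := hbump
  rw [Function.mem_support] at hx₀
  obtain ⟨R, hR⟩ := hbdd.subset_closedBall 0
  have hlip : ∀ z w, |b z - b w| ≤ L * ‖z - w‖ := fun z w => by
    simpa [dist_eq_norm] using hL.dist_le_mul z w
  have hR0 : 0 ≤ R := by
    have := hR (Function.mem_support.2 hx₀)
    rw [mem_closedBall_zero_iff] at this
    exact (norm_nonneg _).trans this
  set S : ℝ := R + ‖x₀‖ + 1 with hS
  have hS0 : 0 < S := by positivity
  set c : ℝ := b x₀ with hc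
  have hc2 : 0 < c ^ 2 := by positivity
  have hzero : ∀ z, R < ‖z‖ → b z = 0 := fun z hz => by
    by_contra h
    have := hR (Function.mem_support.2 h)
    rw [mem_closedBall_zero_iff] at this
    linarith
  set D : ℝ := |c| + L * (R + ‖x₀‖) with hD
  have hD0 : 0 ≤ D := by positivity
  have hbound : ∀ z, |b z - c| ≤ D := fun z => by
    rcases le_or_gt ‖z‖ R with h | h
    · have h1 : ‖z - x₀‖ ≤ R + ‖x₀‖ := (norm_sub_le _ _).trans (by linarith)
      calc |b z - c| ≤ L * ‖z - x₀‖ := hlip z x₀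
        _ ≤ L * (R + ‖x₀‖) := by gcongr
        _ ≤ D := by rw [hD]; linarith [abs_nonneg c]
    · rw [hzero z h, zero_sub, abs_neg, hD]
      have : 0 ≤ L * (R + ‖x₀‖) := by positivity
      linarith
  have hbd := hb.differentiable one_ne_zero
  refine ⟨fun z => (b (x₀ + S • z) - c) ^ 2 / c ^ 2,
    1 + D ^ 2 / c ^ 2 + 2 * D * (L * S) / c ^ 2, ?_, ?_, ?_, ?_, ?_, ?_, ?_⟩
  · have : 0 ≤ D ^ 2 / c ^ 2 + 2 * D * (L * S) / c ^ 2 := by positivity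
    linarith
  · fun_prop
  · simp [hc]
  · intro z; positivity
  · intro z
    have h1 : (b (x₀ + S • z) - c) ^ 2 ≤ D ^ 2 :=
      sq_le_sq' (abs_le.1 (hbound (x₀ + S • z))).1 (abs_le.1 (hbound (x₀ + S • z))).2
    have h2 : (b (x₀ + S • z) - c) ^ 2 / c ^ 2 ≤ D ^ 2 / c ^ 2 := by gcongr
    have h3 : 0 ≤ 2 * D * (L * S) / c ^ 2 := by positivity
    linarith
  · intro z hz
    have h1 : R < ‖x₀ + S • z‖ := by
      have h2 : ‖S • z‖ ≤ ‖x₀ + S • z‖ + ‖x₀‖ := by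
        simpa using norm_sub_le (x₀ + S • z) x₀
      rw [norm_smul, Real.norm_of_nonneg hS0.le] at h2
      nlinarith
    simp [hzero _ h1, div_self hc2.ne']
  · intro z w
    set u := b (x₀ + S • z) - c
    set v := b (x₀ + S • w) - c
    have huv : |u - v| ≤ L * S * ‖z - w‖ := by
      have h1 := hlip (x₀ + S • z) (x₀ + S • w)
      have h2 : x₀ + S • z - (x₀ + S • w) = S • (z - w) := by rw [smul_sub]; abel
      rw [h2, norm_smul, Real.norm_of_nonneg hS0.le, ← mul_assoc] at h1
      have h3 : u - v = b (x₀ + S • z) - b (x₀ + S • w) := by simp only [u, v]; ring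
      rwa [h3]
    have h1 : |u + v| ≤ 2 * D := (abs_add_le _ _).trans
      (by linarith [hbound (x₀ + S • z), hbound (x₀ + S • w)])
    have h2 : |u ^ 2 / c ^ 2 - v ^ 2 / c ^ 2| = |u + v| * |u - v| / c ^ 2 := by
      rw [← sub_div, abs_div, abs_of_pos hc2, ← abs_mul]; ring_nf
    calc |u ^ 2 / c ^ 2 - v ^ 2 / c ^ 2| = |u + v| * |u - v| / c ^ 2 := h2
      _ ≤ 2 * D * (L * S * ‖z - w‖) / c ^ 2 := by gcongr
      _ = 2 * D * (L * S) / c ^ 2 * ‖z - w‖ := by ring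
      _ ≤ _ := by
        gcongr
        have : 0 ≤ D ^ 2 / c ^ 2 := by positivity
        linarith

/-- Smooth variational principle with a compact parameter: a lower semicontinuous function which
is bounded below on `T ×ˢ C` attains its minimum there after a small differentiable perturbation
in the second variable. -/
theorem HasC1LipBump.exists_perturbed_min [CompleteSpace X] (hbump : HasC1LipBump X)
    {T : Set ℝ} (hT : IsCompact T) {C : Set X} (hC : IsClosed C) (hne : (T ×ˢ C).Nonempty)
    {F : ℝ × X → ℝ} (hF : LowerSemicontinuous F) {m : ℝ} (hm : ∀ p ∈ T ×ˢ C, m ≤ F p)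
    {ε : ℝ} (hε : 0 < ε) :
    ∃ g : X → ℝ, Differentiable ℝ g ∧ (∀ z, ‖fderiv ℝ g z‖ ≤ ε) ∧ (∀ z, 0 ≤ g z) ∧
      (∀ z, g z ≤ ε) ∧ ∃ p₀ ∈ T ×ˢ C, ∀ p ∈ T ×ˢ C, F p₀ + g p₀.2 ≤ F p + g p.2 := by
  obtain ⟨φ, N, hN, hφd, hφ0, hφnn, hφN, hφ1, hφL⟩ := hbump.exists_gauge
  have hN0 : 0 < N := by linarith
  set q : ℝ := 1 / (8 * N) with hq
  have hq0 : 0 < q := by positivity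
  have hNq : N * q = 1 / 8 := by rw [hq]; field_simp
  have hq8 : q ≤ 1 / 8 := by nlinarith
  set a : ℝ := ε / (2 * N) with ha
  have ha0 : 0 < a := by positivity
  have haN : a * N = ε / 2 := by rw [ha]; field_simp
  set e : ℕ → ℝ := fun k => a * q ^ k with he
  have he0 : ∀ k, 0 < e k := fun k => by positivity
  set term : ℕ → X → X → ℝ := fun k u z => e k * φ ((2 : ℝ) ^ k • (z - u)) with hterm
  have hpick : ∀ (k : ℕ) (G : X → ℝ), ∃ p ∈ T ×ˢ C, (∀ z, 0 ≤ G z) →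
      ∀ p' ∈ T ×ˢ C, F p + G p.2 ≤ F p' + G p'.2 + e k / 2 := by
    intro k G
    by_cases hG : ∀ z, 0 ≤ G z
    · set V : Set ℝ := (fun p : ℝ × X => F p + G p.2) '' (T ×ˢ C) with hV
      have hbb : BddBelow V := by
        refine ⟨m, ?_⟩
        rintro _ ⟨p, hp, rfl⟩
        have := hm p hp
        have := hG p.2
        simp only
        linarith
      obtain ⟨_, ⟨p, hp, rfl⟩, hlt⟩ :=
        exists_lt_of_csInf_lt (hne.image _) (lt_add_of_pos_right (sInf V) (half_pos (he0 k)))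
      refine ⟨p, hp, fun _ p' hp' => ?_⟩
      have := csInf_le hbb (Set.mem_image_of_mem (fun p : ℝ × X => F p + G p.2) hp')
      simp only at this hlt
      linarith
    · obtain ⟨p, hp⟩ := hne
      exact ⟨p, hp, fun h => absurd h hG⟩
  choose pick hpickmem hpickmin using hpick
  let G : ℕ → X → ℝ := fun k => Nat.rec (motive := fun _ => X → ℝ) (fun _ => 0)
    (fun k G z => G z + term k (pick k G).2 z) k
  set P : ℕ → ℝ × X := fun k => pick k (G k) with hP
  set τ : ℕ → X → ℝ := fun k => term k (P k).2 with hτ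
  have hGsucc : ∀ k z, G (k + 1) z = G k z + τ k z := fun k z => rfl
  have hGsum : ∀ k z, G k z = ∑ i ∈ Finset.range k, τ i z := by
    intro k z
    induction k with
    | zero => rfl
    | succ k ih => rw [hGsucc, Finset.sum_range_succ, ih]
  have hτ0 : ∀ k z, 0 ≤ τ k z := fun k z => mul_nonneg (he0 k).le (hφnn _)
  have hτle : ∀ k z, τ k z ≤ ε / 2 * (1 / 8) ^ k := fun k z => by
    calc τ k z ≤ a * q ^ k * N := mul_le_mul_of_nonneg_left (hφN _) (he0 k).le
      _ = ε / 2 * q ^ k := by rw [← haN]; ring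
      _ ≤ _ := by gcongr
  have hG0 : ∀ k z, 0 ≤ G k z := fun k z => by
    rw [hGsum]; exact Finset.sum_nonneg fun i _ => hτ0 i z
  have hPmem : ∀ k, P k ∈ T ×ˢ C := fun k => hpickmem _ _
  have hPmin : ∀ k, ∀ p ∈ T ×ˢ C, F (P k) + G k (P k).2 ≤ F p + G k p.2 + e k / 2 :=
    fun k => hpickmin k (G k) (hG0 k)
  have hgeo : Summable fun k : ℕ => ε / 2 * (1 / 8 : ℝ) ^ k :=
    (summable_geometric_of_lt_one (by norm_num) (by norm_num)).mul_left _
  have hsum : ∀ z, Summable fun k => τ k z := fun z =>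
    Summable.of_nonneg_of_le (fun k => hτ0 k z) (fun k => hτle k z) hgeo
  set g : X → ℝ := fun z => ∑' k, τ k z with hg
  have hGg : ∀ k z, G k z ≤ g z := fun k z => by
    rw [hGsum]; exact (hsum z).sum_le_tsum _ fun i _ => hτ0 i z
  have hgG : ∀ k z, g z ≤ G k z + N * e k * (8 / 7) := fun k z => by
    have h1 : g z = G k z + ∑' i, τ (i + k) z := by
      rw [hGsum]; exact ((hsum z).sum_add_tsum_nat_add k).symm
    have h2 : HasSum (fun i : ℕ => N * e k * (1 / 8 : ℝ) ^ i) (N * e k * (8 / 7)) := by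
      rw [show (8 / 7 : ℝ) = (1 - 1 / 8)⁻¹ by norm_num]
      exact (hasSum_geometric_of_lt_one (by norm_num) (by norm_num)).mul_left _
    have h3 : ∑' i, τ (i + k) z ≤ N * e k * (8 / 7) := by
      refine h2.tsum_eq ▸ ((summable_nat_add_iff k).2 (hsum z)).tsum_le_tsum (fun i => ?_)
        h2.summable
      calc τ (i + k) z ≤ a * q ^ (i + k) * N := mul_le_mul_of_nonneg_left (hφN _) (he0 _).le
        _ = N * e k * q ^ i := by rw [he]; ring
        _ ≤ _ := by gcongr
    linarith
  have hesucc : ∀ k, N * e (k + 1) = e k / 8 := fun k => by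
    calc N * e (k + 1) = N * q * (a * q ^ k) := by rw [he]; ring
      _ = _ := by rw [hNq]; ring
  have hecomp : ∀ k j, k < j → e j ≤ e k := fun k j hkj =>
    mul_le_mul_of_nonneg_left (pow_le_pow_of_le_one hq0.le (by linarith) hkj.le) ha0.le
  have hclose : ∀ k j, k < j → dist (P k).2 (P j).2 ≤ 1 * (1 / 2) ^ k := by
    intro k j hkj
    by_contra! hcon
    rw [one_mul, dist_comm, dist_eq_norm] at hcon
    have h1 : 1 ≤ φ ((2 : ℝ) ^ k • ((P j).2 - (P k).2)) := by
      apply hφ1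
      rw [norm_smul, norm_pow, Real.norm_ofNat]
      calc (1 : ℝ) = 2 ^ k * (1 / 2) ^ k := by rw [← mul_pow]; norm_num
        _ ≤ _ := by gcongr
    have h2 : e k ≤ τ k (P j).2 := le_mul_of_one_le_right (he0 k).le h1
    have h3 : G (k + 1) (P j).2 ≤ G j (P j).2 := by
      rw [hGsum (k + 1), hGsum j]
      exact Finset.sum_le_sum_of_subset_of_nonneg
        (Finset.range_subset_range.2 hkj) fun i _ _ => hτ0 i _
    have h4 : τ k (P k).2 = 0 := by simp [hτ, hterm, hφ0]
    have h5 := hPmin j _ (hPmem k)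
    have h6 := hPmin k _ (hPmem j)
    have h7 := hGg j (P k).2
    have h8 := hgG (k + 1) (P k).2
    rw [hesucc, hGsucc, h4] at h8
    rw [hGsucc] at h3
    have h9 : e j ≤ e k / 8 := by
      rcases (Nat.succ_le_of_lt hkj).eq_or_lt with h | h
      · have := hesucc k
        have := he0 (k + 1)
        rw [← h]
        simp only [Nat.succ_eq_add_one]
        nlinarith
      · have := hesucc k
        have := he0 (k + 1)
        have := hecomp _ _ h
        simp only [Nat.succ_eq_add_one] at this
        nlinarith
    linarith [he0 k]
  have hcauchy : CauchySeq fun k => (P k).2 :=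
    cauchySeq_of_le_geometric (1 / 2) 1 (by norm_num) fun k => hclose k (k + 1) k.lt_succ_self
  obtain ⟨z₀, hz₀⟩ := cauchySeq_tendsto_of_complete hcauchy
  have hz₀C : z₀ ∈ C := hC.mem_of_tendsto hz₀ (Eventually.of_forall fun k => (hPmem k).2)
  obtain ⟨t₀, ht₀T, ψ, hψ, ht₀⟩ := hT.tendsto_subseq (x := fun k => (P k).1) fun k => (hPmem k).1
  have hPlim : Tendsto (fun k => P (ψ k)) atTop (𝓝 (t₀, z₀)) :=
    ht₀.prodMk_nhds (hz₀.comp hψ.tendsto_atTop)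
  have hτd : ∀ k z, HasFDerivAt (τ k) (fderiv ℝ (τ k) z) z := fun k z => by
    have : Differentiable ℝ (τ k) := by simp only [hτ, hterm]; fun_prop
    exact (this z).hasFDerivAt
  have hτf : ∀ k z, ‖fderiv ℝ (τ k) z‖ ≤ ε / 2 * (1 / 4) ^ k := fun k z => by
    have hnn : 0 ≤ ε / 2 * (1 / 4 : ℝ) ^ k := by positivity
    have hl : LipschitzWith ⟨_, hnn⟩ (τ k) := by
      refine LipschitzWith.of_dist_le_mul fun v w => ?_
      rw [Real.dist_eq, dist_eq_norm]
      have h1 := hφL ((2 : ℝ) ^ k • (v - (P k).2)) ((2 : ℝ) ^ k • (w - (P k).2))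
      rw [← smul_sub, sub_sub_sub_cancel_right, norm_smul, norm_pow, Real.norm_ofNat] at h1
      calc |τ k v - τ k w| = e k * |φ ((2 : ℝ) ^ k • (v - (P k).2))
              - φ ((2 : ℝ) ^ k • (w - (P k).2))| := by
            simp only [hτ, hterm]
            rw [← mul_sub, abs_mul, abs_of_pos (he0 k)]
        _ ≤ e k * (N * (2 ^ k * ‖v - w‖)) := mul_le_mul_of_nonneg_left h1 (he0 k).le
        _ = ε / 2 * (2 * q) ^ k * ‖v - w‖ := by rw [← haN, he, mul_pow]; ring
        _ ≤ ε / 2 * (1 / 4) ^ k * ‖v - w‖ := by gcongr; linarith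
    exact norm_fderiv_le_of_lipschitz ℝ hl
  have hgeo4 : HasSum (fun k : ℕ => ε / 2 * (1 / 4 : ℝ) ^ k) (ε / 2 * (4 / 3)) := by
    rw [show (4 / 3 : ℝ) = (1 - 1 / 4)⁻¹ by norm_num]
    exact (hasSum_geometric_of_lt_one (by norm_num) (by norm_num)).mul_left _
  have hgd : ∀ z, HasFDerivAt g (∑' k, fderiv ℝ (τ k) z) z := fun z =>
    hasFDerivAt_tsum hgeo4.summable hτd hτf (hsum z₀) z
  have hgdiff : Differentiable ℝ g := fun z => (hgd z).differentiableAt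
  refine ⟨g, hgdiff, fun z => ?_, fun z => tsum_nonneg fun k => hτ0 k z, fun z => ?_,
    (t₀, z₀), ⟨ht₀T, hz₀C⟩, fun p hp => ?_⟩
  · rw [(hgd z).fderiv]
    exact (tsum_of_norm_bounded hgeo4 fun k => hτf k z).trans (by linarith)
  · have h1 := hgG 0 z
    have h2 : N * e 0 = ε / 2 := by rw [← haN]; simp only [he]; ring
    have h3 : G 0 z = 0 := rfl
    rw [h2, h3] at h1
    linarith
  · have hlsc : LowerSemicontinuous fun p : ℝ × X => F p + g p.2 :=
      hF.add (hgdiff.continuous.comp continuous_snd).lowerSemicontinuous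
    have helim : Tendsto (fun k => F p + g p.2 + (e (ψ k) / 2 + N * e (ψ k) * (8 / 7))) atTop
        (𝓝 (F p + g p.2)) := by
      have h1 : Tendsto e atTop (𝓝 0) := by
        have := (tendsto_pow_atTop_nhds_zero_of_lt_one hq0.le
          (by linarith : q < 1)).const_mul a
        simpa using this
      have h2 := h1.comp hψ.tendsto_atTop
      have h3 := ((h2.div_const 2).add ((h2.const_mul N).mul_const (8 / 7))).const_add
        (F p + g p.2)
      simpa using h3
    refine le_of_forall_lt fun c hc => ?_
    obtain ⟨c', hcc', hc'⟩ := exists_between hc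
    refine hcc'.trans_le (ge_of_tendsto helim ?_)
    filter_upwards [hPlim.eventually (hlsc (t₀, z₀) c' hc')] with k hk
    have h1 := hPmin (ψ k) p hp
    have h2 := hgG (ψ k) (P (ψ k)).2
    have h3 := hGg (ψ k) p.2
    linarith

/-- If `f + ψ` has a local minimum at a point where `ψ` is differentiable, then minus the
derivative of `ψ` is a Fréchet subgradient of `f`. -/
lemma neg_mem_subdiff_of_isLocalMin_add_s7 {f ψ : X → ℝ} {z : X} {Ψ : X →L[ℝ] ℝ}
    (hψ : HasFDerivAt ψ Ψ z) (hmin : ∀ᶠ w in 𝓝 z, f z + ψ z ≤ f w + ψ w) :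
    -Ψ ∈ subdiff f z := by
  intro ε hε
  have h1 := (hasFDerivAt_iff_isLittleO_nhds_zero.1 hψ).bound hε
  have h2 : ∀ᶠ h in 𝓝 (0 : X), f z + ψ z ≤ f (z + h) + ψ (z + h) := by
    have : Tendsto (fun h : X => z + h) (𝓝 0) (𝓝 z) := by
      simpa using (continuous_const_add z).tendsto 0
    exact this.eventually hmin
  obtain ⟨δ, hδ, h⟩ := Metric.eventually_nhds_iff.1 (h1.and h2)
  refine ⟨δ, hδ, fun w hw => ?_⟩
  obtain ⟨h3, h4⟩ := h (y := w) (by simpa using hw)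
  have h5 := (abs_le.1 h3).2
  simp only [neg_apply]
  linarith

/-- A function minimal at the left end of an interval has nonnegative derivative there. -/
lemma HasDerivAt.nonneg_of_forall_Ioo_le {H : ℝ → ℝ} {d t s : ℝ} (hts : t < s)
    (hH : HasDerivAt H d t) (hmin : ∀ u ∈ Set.Ioo t s, H t ≤ H u) : 0 ≤ d := by
  have h1 : Tendsto (slope H t) (𝓝[>] t) (𝓝 d) :=
    (hasDerivAt_iff_tendsto_slope.1 hH).mono_left
      (nhdsWithin_mono _ fun u hu => (ne_of_gt hu : u ≠ t))
  refine ge_of_tendsto h1 ?_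
  filter_upwards [Ioo_mem_nhdsGT hts] with u hu
  rw [slope_def_field]
  exact div_nonneg (sub_nonneg.2 (hmin u hu)) (sub_nonneg.2 hu.1.le)

/-- One-sided mean value inequality for the Fréchet subdifferential. -/
theorem HasC1LipBump.sub_le_of_subdiff_bound [CompleteSpace X] (hbump : HasC1LipBump X)
    {K : ℝ} (hK : 0 ≤ K) {f : X → ℝ} (hf : LowerSemicontinuous f)
    (hsub : ∀ x : X, ∀ ξ ∈ subdiff f x, ‖ξ‖ ≤ K) (x y : X) :
    f y - f x ≤ K * ‖y - x‖ := by
  by_contra! hcon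
  obtain ⟨r, hr1, hr2⟩ := exists_between hcon
  have hr0 : 0 ≤ r := (by positivity : 0 ≤ K * ‖y - x‖).trans hr1.le
  obtain ⟨φ, N, -, hφd, hφ0, hφnn, -, hφ1, -⟩ := hbump.exists_gauge
  set γ : ℝ → X := fun t => x + t • (y - x) with hγ
  have hγc : Continuous γ := by fun_prop
  set S : Set X := γ '' Set.Icc 0 1 with hS
  have hSc : IsCompact S := isCompact_Icc.image hγc
  have hSne : S.Nonempty := (Set.nonempty_Icc.2 zero_le_one).image _
  obtain ⟨η, hη0, hη1, hηr, hηK⟩ : ∃ η : ℝ, 0 < η ∧ η ≤ 1 ∧ 3 * η ≤ f y - f x - r ∧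
      (K + η) * ‖y - x‖ < r := by
    refine ⟨min 1 (min ((f y - f x - r) / 3) ((r - K * ‖y - x‖) / (‖y - x‖ + 1))), ?_,
      min_le_left _ _, ?_, ?_⟩
    · refine lt_min one_pos (lt_min (by linarith) (div_pos (by linarith) (by positivity)))
    · have := (min_le_right 1 (min ((f y - f x - r) / 3)
        ((r - K * ‖y - x‖) / (‖y - x‖ + 1)))).trans (min_le_left _ _)
      linarith
    · have h1 := (min_le_right 1 (min ((f y - f x - r) / 3)
        ((r - K * ‖y - x‖) / (‖y - x‖ + 1)))).trans (min_le_right _ _)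
      set η := min 1 (min ((f y - f x - r) / 3) ((r - K * ‖y - x‖) / (‖y - x‖ + 1)))
      have h2 : 0 < η :=
        lt_min one_pos (lt_min (by linarith) (div_pos (by linarith) (by positivity)))
      rw [le_div_iff₀ (by positivity)] at h1
      linarith
  obtain ⟨m, δ, hδ0, hm, hδy⟩ : ∃ m δ : ℝ, 0 < δ ∧ (∀ z ∈ Metric.cthickening δ S, m ≤ f z) ∧
      ∀ z, ‖z - y‖ < δ → f y - η < f z := by
    obtain ⟨z₁, -, hz₁⟩ := (hf.lowerSemicontinuousOn S).exists_isMinOn hSne hSc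
    have hopen : IsOpen (f ⁻¹' Set.Ioi (f z₁ - 1)) := hf.isOpen_preimage _
    obtain ⟨δ₁, hδ₁, hsubset⟩ := hSc.exists_cthickening_subset_open hopen fun z hz => by
      have : f z₁ ≤ f z := hz₁ hz
      simp only [Set.mem_preimage, Set.mem_Ioi]
      linarith
    obtain ⟨δ₂, hδ₂, hy⟩ := Metric.eventually_nhds_iff.1 (hf y (f y - η) (by linarith))
    refine ⟨f z₁ - 1, min δ₁ δ₂, lt_min hδ₁ hδ₂, fun z hz => ?_, fun z hz => ?_⟩
    · exact le_of_lt (hsubset (Metric.cthickening_mono (min_le_left _ _) S hz))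
    · exact hy (by rw [dist_eq_norm]; exact hz.trans_le (min_le_right _ _))
  set M : ℝ := |f x| + |m| + r + 2 with hM
  have hM0 : 0 ≤ M := by positivity
  set Φ : X → ℝ := fun w => M * φ (δ⁻¹ • w) with hΦ
  have hΦd : Differentiable ℝ Φ := by fun_prop
  have hΦ0 : Φ 0 = 0 := by simp [hΦ, hφ0]
  have hΦnn : ∀ w, 0 ≤ Φ w := fun w => mul_nonneg hM0 (hφnn _)
  have hΦM : ∀ w, δ ≤ ‖w‖ → M ≤ Φ w := fun w hw => by
    refine le_mul_of_one_le_right hM0 (hφ1 _ ?_)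
    rw [norm_smul, norm_inv, Real.norm_of_nonneg hδ0.le, inv_mul_eq_div, one_le_div hδ0]
    exact hw
  set F : ℝ × X → ℝ := fun p => f p.2 + (-(r * p.1) + Φ (p.2 - γ p.1)) with hFdef
  have hF : LowerSemicontinuous F := by
    have hΦc := hΦd.continuous
    exact (hf.comp continuous_snd).add
      (by fun_prop : Continuous fun p : ℝ × X =>
        -(r * p.1) + Φ (p.2 - γ p.1)).lowerSemicontinuous
  have hrt : ∀ t ∈ Set.Icc (0 : ℝ) 1, r * t ≤ r := fun t ht => mul_le_of_le_one_right hr0 ht.2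
  have hxS : x ∈ Metric.cthickening δ S :=
    Metric.self_subset_cthickening S ⟨0, by simp, by simp [hγ]⟩
  have h0x : ((0 : ℝ), x) ∈ Set.Icc (0 : ℝ) 1 ×ˢ Metric.cthickening δ S := ⟨by simp, hxS⟩
  obtain ⟨g, hgd, hgη, hg0, hgle, ⟨t₀, z₀⟩, ⟨ht₀, hz₀⟩, hmin⟩ :=
    hbump.exists_perturbed_min isCompact_Icc Metric.isClosed_cthickening ⟨_, h0x⟩ hF
      (m := m - r) (fun p hp => by
        have h1 := hm p.2 hp.2
        have h2 := hrt p.1 hp.1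
        have h3 := hΦnn (p.2 - γ p.1)
        simp only [hFdef]
        linarith) hη0
  simp only at ht₀ hz₀
  have hval : f z₀ + (-(r * t₀) + Φ (z₀ - γ t₀)) ≤ f x + η := by
    have h1 := hmin _ h0x
    have h2 : x - γ 0 = 0 := by simp [hγ]
    simp only [hFdef, h2, hΦ0] at h1
    linarith [hgle x, hg0 z₀]
  have hnear : ‖z₀ - γ t₀‖ < δ := by
    by_contra! h
    have h1 := hΦM _ h
    have h2 := hm _ hz₀
    have h3 := hrt _ ht₀
    have h4 := le_abs_self (f x)
    have h5 := neg_abs_le m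
    linarith
  have ht₀1 : t₀ < 1 := by
    refine lt_of_le_of_ne ht₀.2 fun h => ?_
    have h1 : γ t₀ = y := by simp [hγ, h]
    have h2 := hΦnn (z₀ - γ t₀)
    rw [h1] at hnear
    have h3 := hδy _ hnear
    rw [h] at hval h2
    linarith
  set D : X →L[ℝ] ℝ := fderiv ℝ Φ (z₀ - γ t₀) with hD
  have hDΦ : HasFDerivAt Φ D (z₀ - γ t₀) := (hΦd _).hasFDerivAt
  have hξ : -(D + fderiv ℝ g z₀) ∈ subdiff f z₀ := by
    refine neg_mem_subdiff_of_isLocalMin_add_s7 (ψ := fun z => Φ (z - γ t₀) + g z) ?_ ?_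
    · refine HasFDerivAt.add ?_ (hgd z₀).hasFDerivAt
      simpa [Function.comp_def] using hDΦ.comp z₀ ((hasFDerivAt_id z₀).sub_const (γ t₀))
    · have hz₀' : Metric.ball (γ t₀) δ ∈ 𝓝 z₀ :=
        Metric.isOpen_ball.mem_nhds (by rwa [Metric.mem_ball, dist_eq_norm])
      filter_upwards [hz₀'] with w hw
      have hw' : w ∈ Metric.cthickening δ S :=
        Metric.thickening_subset_cthickening δ S
          (Metric.mem_thickening_iff.2 ⟨γ t₀, ⟨t₀, ht₀, rfl⟩, hw⟩)
      have := hmin (t₀, w) ⟨ht₀, hw'⟩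
      simp only [hFdef] at this
      linarith
  have hDnorm : ‖D‖ ≤ K + η := by
    have h1 := hsub _ _ hξ
    rw [norm_neg] at h1
    have h2 := norm_sub_le (D + fderiv ℝ g z₀) (fderiv ℝ g z₀)
    rw [add_sub_cancel_right] at h2
    linarith [hgη z₀]
  have hderiv : HasDerivAt (fun t => -(r * t) + Φ (z₀ - γ t)) (-r + D (-(y - x))) t₀ := by
    refine HasDerivAt.add ?_ ?_
    · simpa using (hasDerivAt_id t₀).const_mul r |>.fun_neg
    · have hγd : HasDerivAt (fun t => z₀ - γ t) (-(y - x)) t₀ := by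
        have := (((hasDerivAt_id t₀).smul_const (y - x)).const_add x).const_sub z₀
        simpa [hγ] using this
      exact hDΦ.comp_hasDerivAt t₀ hγd
  have hnn := hderiv.nonneg_of_forall_Ioo_le ht₀1 fun u hu => by
    have := hmin (u, z₀) ⟨⟨ht₀.1.trans hu.1.le, hu.2.le⟩, hz₀⟩
    simp only [hFdef] at this
    linarith
  have h1 : D (-(y - x)) ≤ ‖D‖ * ‖y - x‖ := by
    have := (le_abs_self _).trans (D.le_opNorm (-(y - x)))
    rwa [norm_neg] at this
  have h2 : ‖D‖ * ‖y - x‖ ≤ (K + η) * ‖y - x‖ := by gcongr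
  linarith

theorem stmt7 [CompleteSpace X] (hbump : HasC1LipBump X)
    (K : ℝ) (hK : 0 ≤ K) (f : X → ℝ) (hf : LowerSemicontinuous f)
    (hsub : ∀ x : X, ∀ ξ ∈ subdiff f x, ‖ξ‖ ≤ K) :
    ∀ x y : X, |f x - f y| ≤ K * ‖x - y‖ := by
  intro x y
  have h1 := hbump.sub_le_of_subdiff_bound hK hf hsub x y
  have h2 := hbump.sub_le_of_subdiff_bound hK hf hsub y x
  rw [norm_sub_rev] at h1
  exact abs_le.2 ⟨by linarith, h2⟩
end

section
/- Let X be a nontrivial real Banach space admitting a C¹ Lipschitz bump function, and let Ω ⊆ X be a nonempty bounded open set with ∂Ω ≠ ∅. Then there is no classical solution of the eikonal equation on Ω: there is no continuous function u : cl(Ω) → ℝ which is Fréchet differentiable at every point of Ω with ‖Du(x)‖ = 1 for all x ∈ Ω and u(x) = 0 for all x ∈ ∂Ω. -/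
open Filter Topology

variable {X : Type*} [NormedAddCommGroup X] [NormedSpace ℝ X]

/-- **Ekeland's variational principle** for continuous functions bounded above. -/
theorem exists_forall_sub_lt_mul_dist {α : Type*} [MetricSpace α] [CompleteSpace α]
    {f : α → ℝ} (hf : Continuous f) (hbdd : BddAbove (Set.range f)) {ε : ℝ} (hε : 0 < ε)
    (x₀ : α) : ∃ x, f x₀ ≤ f x ∧ ∀ y, y ≠ x → f y - f x < ε * dist x y := by
  have key : ∀ (x : α) (n : ℕ), ∃ y, ε * dist x y ≤ f y - f x ∧
      ∀ z, ε * dist x z ≤ f z - f x → f z ≤ f y + (1 / 2) ^ n := by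
    intro x n
    let T : Set ℝ := f '' {y | ε * dist x y ≤ f y - f x}
    have hT : T.Nonempty := ⟨f x, x, by simp, rfl⟩
    have hTb : BddAbove T := hbdd.mono (Set.image_subset_range _ _)
    have hlt : sSup T - (1 / 2) ^ n < sSup T := sub_lt_self _ (by positivity)
    obtain ⟨_, ⟨y, hy, rfl⟩, hy'⟩ := exists_lt_of_lt_csSup hT hlt
    refine ⟨y, hy, fun z hz => ?_⟩
    have : f z ≤ sSup T := le_csSup hTb ⟨z, hz, rfl⟩
    linarith
  choose F hF hFsup using key
  let s : ℕ → α := fun n => Nat.rec x₀ (fun n x => F x n) n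
  have hs : ∀ n, s (n + 1) = F (s n) n := fun _ => rfl
  have htrans : ∀ {x y z : α}, ε * dist x y ≤ f y - f x → ε * dist y z ≤ f z - f y →
      ε * dist x z ≤ f z - f x := by
    intro x y z h₁ h₂
    have := mul_le_mul_of_nonneg_left (dist_triangle x y z) hε.le
    linarith
  have hle : ∀ n m, n ≤ m → ε * dist (s n) (s m) ≤ f (s m) - f (s n) := by
    intro n m hnm
    induction m, hnm using Nat.le_induction with
    | base => simp
    | succ m _ ih => exact htrans ih (by rw [hs]; exact hF _ _)
  have hmono : Monotone (fun n => f (s n)) := by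
    intro n m hnm
    have := hle n m hnm
    have h0 : 0 ≤ ε * dist (s n) (s m) := by positivity
    simp only
    linarith
  have hcf : CauchySeq (fun n => f (s n)) :=
    (tendsto_atTop_ciSup hmono (hbdd.mono (Set.range_comp_subset_range s f))).cauchySeq
  have hcs : CauchySeq s := by
    rw [Metric.cauchySeq_iff'] at hcf ⊢
    intro δ hδ
    obtain ⟨N, hN⟩ := hcf (ε * δ) (by positivity)
    refine ⟨N, fun n hn => ?_⟩
    have h₁ := hle N n hn
    have h₂ := hN n hn
    rw [Real.dist_eq] at h₂
    have h₃ := le_abs_self (f (s n) - f (s N))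
    rw [dist_comm]
    exact lt_of_mul_lt_mul_left (by linarith) hε.le
  obtain ⟨x, hx⟩ := cauchySeq_tendsto_of_complete hcs
  have hfx : Tendsto (fun n => f (s n)) atTop (𝓝 (f x)) := (hf.tendsto x).comp hx
  have hsx : ∀ n, ε * dist (s n) x ≤ f x - f (s n) := fun n =>
    le_of_tendsto_of_tendsto ((tendsto_const_nhds.dist hx).const_mul ε) (hfx.sub_const _)
      (eventually_atTop.2 ⟨n, fun m hm => hle n m hm⟩)
  refine ⟨x, hmono.ge_of_tendsto hfx 0, fun y hyx => ?_⟩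
  by_contra! hy
  have hfy : f y ≤ f x := by
    have hlim : Tendsto (fun n : ℕ => f (s (n + 1)) + (1 / 2 : ℝ) ^ n) atTop (𝓝 (f x + 0)) :=
      (hfx.comp (tendsto_add_atTop_nat 1)).add
        (tendsto_pow_atTop_nhds_zero_of_lt_one (by norm_num) (by norm_num))
    rw [add_zero] at hlim
    exact ge_of_tendsto' hlim fun n => hFsup (s n) n y (htrans (hsx n) hy)
  have : 0 < ε * dist x y := mul_pos hε (dist_pos.2 hyx.symm)
  linarith

/-- A derivative is bounded in norm by any one-sided local Lipschitz constant at the point. -/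
theorem HasFDerivAt.norm_le_of_eventually_sub_le {E : Type*} [NormedAddCommGroup E]
    [NormedSpace ℝ E] {u : E → ℝ} {Δ : E →L[ℝ] ℝ} {x : E} (h : HasFDerivAt u Δ x) {C : ℝ}
    (hC : 0 ≤ C) (hle : ∀ᶠ y in 𝓝 x, u y - u x ≤ C * ‖y - x‖) : ‖Δ‖ ≤ C := by
  have hdir : ∀ v, Δ v ≤ C * ‖v‖ := by
    intro v
    have hderiv : HasDerivAt (fun t : ℝ => u (x + t • v)) (Δ v) 0 := by
      have hline : HasDerivAt (fun t : ℝ => x + t • v) v 0 := by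
        simpa using ((hasDerivAt_id (0 : ℝ)).smul_const v).const_add x
      have h' : HasFDerivAt u Δ (x + (0 : ℝ) • v) := by simpa using h
      exact h'.comp_hasDerivAt 0 hline
    have hcont : Tendsto (fun t : ℝ => x + t • v) (𝓝[>] 0) (𝓝 x) := by
      have : Continuous (fun t : ℝ => x + t • v) := by fun_prop
      simpa using (this.tendsto 0).mono_left nhdsWithin_le_nhds
    refine le_of_tendsto hderiv.tendsto_slope_zero_right ?_
    filter_upwards [hcont.eventually hle, self_mem_nhdsWithin] with t ht ht0
    have ht0 : 0 < t := ht0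
    rw [add_sub_cancel_left, norm_smul, Real.norm_of_nonneg ht0.le] at ht
    simp only [zero_add, zero_smul, add_zero, smul_eq_mul]
    rw [inv_mul_le_iff₀ ht0]
    linarith
  refine Δ.opNorm_le_bound hC fun v => abs_le.2 ⟨?_, hdir v⟩
  have := hdir (-v)
  rw [map_neg, norm_neg] at this
  linarith

/-- A ray starting in a bounded open set leaves it through a frontier point, at a time bounded
by any number that bounds the distances within the set. -/
theorem IsOpen.exists_ray_exit {E : Type*} [NormedAddCommGroup E] [NormedSpace ℝ E] {Ω : Set E}
    (hΩ : IsOpen Ω) {R : ℝ} (hR : ∀ x ∈ Ω, ∀ y ∈ Ω, dist x y < R) {x v : E} (hx : x ∈ Ω)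
    (hv : ‖v‖ = 1) : ∃ t, 0 < t ∧ t ≤ R ∧ x + t • v ∈ frontier Ω ∧
      ∀ s ∈ Set.Ico 0 t, x + s • v ∈ Ω := by
  have hcont : Continuous (fun t : ℝ => x + t • v) := by fun_prop
  have hR0 : 0 < R := by simpa using hR x hx x hx
  let S : Set ℝ := Set.Ici 0 ∩ (fun t : ℝ => x + t • v) ⁻¹' Ωᶜ
  have hS : IsClosed S := isClosed_Ici.inter (hΩ.isClosed_compl.preimage hcont)
  have hRS : R ∈ S := by
    refine ⟨hR0.le, fun hmem => ?_⟩
    have := hR _ hx _ hmem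
    rw [dist_self_add_right, norm_smul, hv, Real.norm_of_nonneg hR0.le] at this
    linarith
  have hSb : BddBelow S := ⟨0, fun t ht => ht.1⟩
  have hmem : sInf S ∈ S := hS.csInf_mem ⟨R, hRS⟩ hSb
  have hin : ∀ s ∈ Set.Ico 0 (sInf S), x + s • v ∈ Ω := by
    intro s hs
    by_contra hsΩ
    exact absurd (csInf_le hSb (show s ∈ S from ⟨hs.1, hsΩ⟩)) (not_le.2 hs.2)
  have hpos : 0 < sInf S := by
    refine lt_of_le_of_ne hmem.1 fun h0 => hmem.2 ?_
    rw [← h0]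
    simpa using hx
  refine ⟨sInf S, hpos, csInf_le hSb hRS, ?_, hin⟩
  rw [hΩ.frontier_eq]
  refine ⟨?_, hmem.2⟩
  have : sInf S ∈ closure (Set.Ico 0 (sInf S)) := by
    rw [closure_Ico hpos.ne]
    exact ⟨hpos.le, le_rfl⟩
  exact map_mem_closure (f := fun t : ℝ => x + t • v) hcont this hin

/-- On a bounded open set, a function vanishing on the frontier whose derivative has norm at
most one is bounded above. -/
theorem exists_le_of_norm_fderiv_le_one {E : Type*} [NormedAddCommGroup E] [NormedSpace ℝ E]
    [Nontrivial E] {Ω : Set E} (hΩ : IsOpen Ω) (hb : Bornology.IsBounded Ω) {u : E → ℝ}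
    (hu : ContinuousOn u (closure Ω))
    (hd : ∀ x ∈ Ω, ∃ Δ : E →L[ℝ] ℝ, HasFDerivAt u Δ x ∧ ‖Δ‖ ≤ 1)
    (h0 : ∀ x ∈ frontier Ω, u x = 0) : ∃ R, ∀ x ∈ closure Ω, u x ≤ R := by
  obtain ⟨C, hC⟩ := Metric.isBounded_iff.1 hb
  obtain ⟨v, hv⟩ := exists_norm_eq E zero_le_one
  refine ⟨|C| + 1, fun x hx => ?_⟩
  by_cases hxΩ : x ∈ Ω
  swap
  · rw [h0 x (by rw [hΩ.frontier_eq]; exact ⟨hx, hxΩ⟩)]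
    positivity
  obtain ⟨t, ht0, htR, htf, hin⟩ := hΩ.exists_ray_exit (R := |C| + 1)
    (fun x hx y hy => by linarith [hC hx hy, le_abs_self C]) hxΩ hv
  choose! D hD hD1 using hd
  have hderiv : ∀ s ∈ Set.Ioo 0 t, HasDerivAt (fun s : ℝ => u (x + s • v)) (D (x + s • v) v) s := by
    intro s hs
    have hline : HasDerivAt (fun t : ℝ => x + t • v) v s := by
      simpa using ((hasDerivAt_id s).smul_const v).const_add x
    exact (hD _ (hin s ⟨hs.1.le, hs.2⟩)).comp_hasDerivAt s hline
  have hcont : ContinuousOn (fun s : ℝ => u (x + s • v)) (Set.Icc 0 t) := by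
    refine hu.comp (by fun_prop) fun s hs => ?_
    rcases hs.2.lt_or_eq with h | rfl
    · exact subset_closure (hin s ⟨hs.1, h⟩)
    · exact frontier_subset_closure htf
  obtain ⟨c, hc, hslope⟩ := exists_hasDerivAt_eq_slope _ _ ht0 hcont hderiv
  simp only [h0 _ htf, zero_smul, add_zero, sub_zero, zero_sub] at hslope
  rw [eq_div_iff ht0.ne'] at hslope
  have hbound : |D (x + c • v) v| ≤ 1 := by
    have h₁ := (D (x + c • v)).le_opNorm v
    rw [hv, mul_one] at h₁
    exact h₁.trans (hD1 _ (hin c ⟨hc.1.le, hc.2⟩))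
  nlinarith [(abs_le.1 hbound).1]

/-- A function with unit derivative on a bounded open set and vanishing on the frontier is
nonpositive. -/
theorem nonpos_of_norm_fderiv_eq_one {E : Type*} [NormedAddCommGroup E] [NormedSpace ℝ E]
    [CompleteSpace E] [Nontrivial E] {Ω : Set E} (hΩ : IsOpen Ω) (hb : Bornology.IsBounded Ω)
    {u : E → ℝ} (hu : ContinuousOn u (closure Ω))
    (hd : ∀ x ∈ Ω, ∃ Δ : E →L[ℝ] ℝ, HasFDerivAt u Δ x ∧ ‖Δ‖ = 1)
    (h0 : ∀ x ∈ frontier Ω, u x = 0) {x : E} (hx : x ∈ Ω) : u x ≤ 0 := by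
  by_contra! hpos
  obtain ⟨R, hR⟩ := exists_le_of_norm_fderiv_le_one hΩ hb hu
    (fun x hx => (hd x hx).imp fun _ h => ⟨h.1, h.2.le⟩) h0
  have : CompleteSpace (closure Ω) := isClosed_closure.completeSpace_coe
  obtain ⟨⟨z, hz⟩, hxz, hmax⟩ := exists_forall_sub_lt_mul_dist (f := (closure Ω).domRestrict u)
    hu.domRestrict ⟨R, by rintro _ ⟨y, rfl⟩; exact hR y y.2⟩ (one_half_pos (α := ℝ))
    ⟨x, subset_closure hx⟩
  simp only [Set.domRestrict_apply] at hxz hmax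
  have hzΩ : z ∈ Ω := by
    by_contra hzΩ
    rw [h0 z (by rw [hΩ.frontier_eq]; exact ⟨hz, hzΩ⟩)] at hxz
    linarith
  obtain ⟨Δ, hΔ, hΔ1⟩ := hd z hzΩ
  have : ‖Δ‖ ≤ 1 / 2 := by
    refine hΔ.norm_le_of_eventually_sub_le (by norm_num) ?_
    filter_upwards [hΩ.mem_nhds hzΩ] with y hy
    rcases eq_or_ne y z with rfl | hyz
    · simp
    · have := hmax ⟨y, subset_closure hy⟩ (by simpa [Subtype.ext_iff] using hyz)
      rw [Subtype.dist_eq, dist_comm, dist_eq_norm] at this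
      exact this.le
  norm_num [hΔ1] at this

theorem stmt9 [CompleteSpace X] [Nontrivial X] (hbump : HasC1LipBump X)
    (Ω : Set X) (hΩopen : IsOpen Ω) (hΩne : Ω.Nonempty)
    (hΩbdd : Bornology.IsBounded Ω) (hbd : (frontier Ω).Nonempty) :
    ¬ ∃ u : X → ℝ, ContinuousOn u (closure Ω) ∧
      (∀ x ∈ Ω, ∃ Δ : X →L[ℝ] ℝ, HasFDerivAt u Δ x ∧ ‖Δ‖ = 1) ∧
      (∀ x ∈ frontier Ω, u x = 0) := by
  rintro ⟨u, hu, hd, h0⟩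
  have hzero : ∀ x ∈ Ω, u x = 0 := by
    refine fun x hx => le_antisymm (nonpos_of_norm_fderiv_eq_one hΩopen hΩbdd hu hd h0 hx) ?_
    have := nonpos_of_norm_fderiv_eq_one (u := fun x => -u x) hΩopen hΩbdd hu.neg
      (fun y hy => by
        obtain ⟨Δ, hΔ, h1⟩ := hd y hy
        exact ⟨-Δ, hΔ.neg, by rwa [norm_neg]⟩)
      (fun y hy => by simp [h0 y hy]) hx
    linarith
  obtain ⟨x, hx⟩ := hΩne
  obtain ⟨Δ, hΔ, h1⟩ := hd x hx
  have : ‖Δ‖ ≤ 0 := by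
    refine hΔ.norm_le_of_eventually_sub_le le_rfl ?_
    filter_upwards [hΩopen.mem_nhds hx] with y hy
    simp [hzero y hy, hzero x hx]
  linarith
end

section
/- Let X be a real Banach space admitting a C¹ Lipschitz bump function, let Ω ⊆ X be a nonempty bounded open set with ∂Ω ≠ ∅, and let h : X → ℝ satisfy |h(y) − h(z)| ≤ ‖y − z‖ for all y, z ∈ ∂Ω. Define u : cl(Ω) → ℝ by u(x) = inf{h(y) + ‖y − x‖ : y ∈ ∂Ω}. Then u is a viscosity solution of the eikonal equation with boundary data h; namely: (i) u(x) = h(x) for every x ∈ ∂Ω; (ii) ‖Δ‖ ≥ 1 for every x ∈ Ω and every Δ ∈ D⁻u(x); and (iii) ‖Λ‖ ≤ 1 for every x ∈ Ω and every Λ ∈ D⁺u(x). -/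
open Filter Topology

variable {X : Type*} [NormedAddCommGroup X] [NormedSpace ℝ X]

/-- The Fréchet subdifferential at `x` of a real-valued function `f` regarded as a
function defined on the set `Ω`. -/
def subdiffOn (Ω : Set X) (f : X → ℝ) (x : X) : Set (X →L[ℝ] ℝ) :=
  {Δ | ∀ ε > (0:ℝ), ∃ δ > (0:ℝ), ∀ h : X, ‖h‖ < δ → x + h ∈ Ω →
    f x + Δ h - ε * ‖h‖ ≤ f (x + h)}

/-- The Fréchet superdifferential at `x` of a real-valued function `f` regarded as a
function defined on the set `Ω`. -/
def superdiffOn (Ω : Set X) (f : X → ℝ) (x : X) : Set (X →L[ℝ] ℝ) :=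
  {Δ | ∀ ε > (0:ℝ), ∃ δ > (0:ℝ), ∀ h : X, ‖h‖ < δ → x + h ∈ Ω →
    f (x + h) ≤ f x + Δ h + ε * ‖h‖}

/-- The family defining the McShane extension of a 1-Lipschitz `g : S → ℝ` is bounded below. -/
theorem bddBelow_image_add_norm_sub {E : Type*} [SeminormedAddCommGroup E] {S : Set E} {g : E → ℝ}
    (hg : ∀ y ∈ S, ∀ z ∈ S, |g y - g z| ≤ ‖y - z‖) (x : E) :
    BddBelow ((fun y => g y + ‖y - x‖) '' S) := by
  rcases S.eq_empty_or_nonempty with rfl | ⟨y₀, hy₀⟩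
  · simp
  refine ⟨g y₀ - ‖y₀ - x‖, ?_⟩
  rintro _ ⟨y, hy, rfl⟩
  have h₁ := (abs_le.1 (hg y₀ hy₀ y hy)).2
  have h₂ := norm_sub_le_norm_sub_add_norm_sub y₀ x y
  rw [norm_sub_rev x y] at h₂
  dsimp only
  linarith

/-- The McShane extension is 1-Lipschitz. -/
theorem sInf_image_add_norm_sub_le_add {E : Type*} [SeminormedAddCommGroup E] {S : Set E}
    {g : E → ℝ} (hS : S.Nonempty) (hg : ∀ y ∈ S, ∀ z ∈ S, |g y - g z| ≤ ‖y - z‖) (x v : E) :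
    sInf ((fun y => g y + ‖y - x‖) '' S) ≤
      sInf ((fun y => g y + ‖y - (x + v)‖) '' S) + ‖v‖ := by
  rw [← sub_le_iff_le_add]
  refine le_csInf (hS.image _) ?_
  rintro _ ⟨y, hy, rfl⟩
  have h₁ := csInf_le (bddBelow_image_add_norm_sub hg x) (Set.mem_image_of_mem _ hy)
  have h₂ := norm_add_le (y - (x + v)) v
  rw [show y - (x + v) + v = y - x by abel] at h₂
  dsimp only at h₁ ⊢
  linarith

/-- The McShane extension agrees with the original function on `S`. -/
theorem sInf_image_add_norm_sub_eq {E : Type*} [SeminormedAddCommGroup E] {S : Set E} {g : E → ℝ}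
    (hg : ∀ y ∈ S, ∀ z ∈ S, |g y - g z| ≤ ‖y - z‖) {x : E} (hx : x ∈ S) :
    sInf ((fun y => g y + ‖y - x‖) '' S) = g x := by
  refine IsLeast.csInf_eq ⟨⟨x, hx, by simp⟩, ?_⟩
  rintro _ ⟨y, hy, rfl⟩
  have := (abs_le.1 (hg x hx y hy)).2
  rw [norm_sub_rev] at this
  dsimp only
  linarith

/-- A superdifferential at an interior point of a function decreasing at most at unit rate has norm
at most one. -/
theorem norm_le_one_of_mem_superdiffOn {A : Set X} {f : X → ℝ} {x : X} (hA : A ∈ 𝓝 x)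
    (hf : ∀ v, f x ≤ f (x + v) + ‖v‖) {Λ : X →L[ℝ] ℝ} (hΛ : Λ ∈ superdiffOn A f x) :
    ‖Λ‖ ≤ 1 := by
  refine le_of_forall_pos_le_add fun ε hε => ?_
  obtain ⟨δ, hδ, H⟩ := hΛ ε hε
  obtain ⟨r, hr, hrA⟩ := Metric.mem_nhds_iff.1 hA
  have key : ∀ v : X, ‖v‖ < min δ r → -Λ v ≤ (1 + ε) * ‖v‖ := fun v hv => by
    have h₁ := H v (hv.trans_le (min_le_left _ _))
      (hrA (by simpa using hv.trans_le (min_le_right _ _)))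
    linarith [hf v]
  refine Λ.opNorm_le_of_ball (lt_min hδ hr) (by positivity) fun v hv => ?_
  rw [mem_ball_zero_iff] at hv
  rw [Real.norm_eq_abs, abs_le']
  refine ⟨?_, key v hv⟩
  simpa using key (-v) (by simpa using hv)

/-- The McShane extension from a set avoiding a neighbourhood of `x` decreases at unit rate from `x`
in some direction, so its subdifferentials at `x` have norm at least one. -/
theorem one_le_norm_of_mem_subdiffOn {A S : Set X} {g u : X → ℝ} {x : X} (hA : A ∈ 𝓝 x)
    (hSx : Sᶜ ∈ 𝓝 x) (hS : S.Nonempty) (hg : ∀ y ∈ S, ∀ z ∈ S, |g y - g z| ≤ ‖y - z‖)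
    (hu : ∀ x, u x = sInf ((fun y => g y + ‖y - x‖) '' S))
    {Δ : X →L[ℝ] ℝ} (hΔ : Δ ∈ subdiffOn A u x) : 1 ≤ ‖Δ‖ := by
  refine le_of_forall_pos_le_add fun ε hε => ?_
  obtain ⟨δ, hδ, H⟩ := hΔ (ε / 2) (by positivity)
  obtain ⟨r, hr, hrA⟩ := Metric.mem_nhds_iff.1 (inter_mem hA hSx)
  obtain ⟨t, ht, htδr⟩ := exists_between (lt_min hδ hr)
  obtain ⟨htδ, htr⟩ := lt_min_iff.1 htδr
  obtain ⟨_, ⟨y, hy, rfl⟩, hyu⟩ := exists_lt_of_csInf_lt (hS.image _)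
    (show sInf ((fun y => g y + ‖y - x‖) '' S) < u x + ε / 2 * t by
      rw [← hu]; linarith [mul_pos (half_pos hε) ht])
  have hry : r ≤ ‖y - x‖ := by
    by_contra! hlt
    exact (hrA (mem_ball_iff_norm.2 hlt)).2 hy
  have hpos : 0 < ‖y - x‖ := hr.trans_le hry
  set v : X := (t / ‖y - x‖) • (y - x) with hv
  have hvn : ‖v‖ = t := by
    rw [hv, norm_smul, Real.norm_of_nonneg (by positivity), div_mul_cancel₀ _ hpos.ne']
  have hyv : ‖y - (x + v)‖ = ‖y - x‖ - t := by
    have hle : 0 ≤ 1 - t / ‖y - x‖ := sub_nonneg.2 ((div_le_one hpos).2 (htr.le.trans hry))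
    rw [show y - (x + v) = (1 - t / ‖y - x‖) • (y - x) by rw [hv]; module, norm_smul,
      Real.norm_of_nonneg hle, sub_mul, one_mul, div_mul_cancel₀ _ hpos.ne']
  have h₁ := H v (by rwa [hvn]) (hrA (by simpa [hvn] using htr)).1
  have h₂ : u (x + v) ≤ g y + ‖y - (x + v)‖ := by
    rw [hu]
    exact csInf_le (bddBelow_image_add_norm_sub hg _) ⟨y, hy, rfl⟩
  have h₃ : -Δ v ≤ ‖Δ‖ * t := by
    rw [← hvn]
    exact (neg_le_abs _).trans (Δ.le_opNorm v)
  dsimp only at hyu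
  rw [hvn] at h₁
  refine le_of_mul_le_mul_right ?_ ht
  linarith

theorem stmt10 [CompleteSpace X] (hbump : HasC1LipBump X)
    (Ω : Set X) (hΩopen : IsOpen Ω) (hΩne : Ω.Nonempty)
    (hΩbdd : Bornology.IsBounded Ω) (hbd : (frontier Ω).Nonempty)
    (h : X → ℝ) (hLip : ∀ y ∈ frontier Ω, ∀ z ∈ frontier Ω, |h y - h z| ≤ ‖y - z‖)
    (u : X → ℝ)
    (hu : ∀ x : X, u x = sInf ((fun y => h y + ‖y - x‖) '' frontier Ω)) :
    (∀ x ∈ frontier Ω, u x = h x) ∧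
    (∀ x ∈ Ω, ∀ Δ ∈ subdiffOn (closure Ω) u x, 1 ≤ ‖Δ‖) ∧
    (∀ x ∈ Ω, ∀ Λ ∈ superdiffOn (closure Ω) u x, ‖Λ‖ ≤ 1) := by
  refine ⟨fun x hx => (hu x).trans (sInf_image_add_norm_sub_eq hLip hx), fun x hx Δ hΔ => ?_,
    fun x hx Λ hΛ => ?_⟩
  · have hΩx := hΩopen.mem_nhds hx
    refine one_le_norm_of_mem_subdiffOn (mem_of_superset hΩx subset_closure)
      (mem_of_superset hΩx ?_) hbd hLip hu hΔ
    exact fun z hz hzf => hzf.2 (hΩopen.interior_eq.symm ▸ hz)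
  · refine norm_le_one_of_mem_superdiffOn
      (mem_of_superset (hΩopen.mem_nhds hx) subset_closure) (fun v => ?_) hΛ
    rw [hu, hu]
    exact sInf_image_add_norm_sub_le_add hbd hLip x v
end
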